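/- Let I = {1,…,κ} with κ ≥ 2 and for each i ∈ I let A_i ∈ ℝ^{d×d} be invertible with ‖A_i‖ ≤ ᾱ < 1. Suppose that for a given t ≥ 0 there exists a constant D ≥ 1 such that D^{-1}·φ^t(A_𝚒)·φ^t(A_𝚓) ≤ φ^t(A_{𝚒𝚓}) for all finite words 𝚒, 𝚓. Then there exist a Borel probability measure μ on I^ℕ, a constant c ≥ 1, and numbers 1 > λ₁ ≥ λ₂ ≥ … ≥ λ_d > 0 such that: (1) c^{-1}·e^{−|𝚒|·P(t)}·φ^t(A_𝚒) ≤ μ([𝚒]) ≤ c·e^{−|𝚒|·P(t)}·φ^t(A_𝚒) for every finite word 𝚒; and (2) for μ-almost every 𝚒 ∈ I^ℕ and every k ∈ {1,…,d}, lim_{n→∞} α_k(A_{𝚒|_n})^{1/n} = λ_k. -/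

import Mathlib

open MeasureTheory Filter Matrix Real Set

noncomputable section

/-- operator (Euclidean) norm of a `d × d` real matrix -/
noncomputable def opN {d : ℕ} (A : Matrix (Fin d) (Fin d) ℝ) : ℝ :=
  ‖LinearMap.toContinuousLinearMap (Matrix.toEuclideanLin A)‖

/-- the `k`-th singular value (`k = 1, …, d`), characterized by the Courant–Fischer
minimax principle: `α_k(A) = sup {inf {‖Ax‖ : x ∈ V, ‖x‖ = 1} : dim V = k}`. -/
noncomputable def singVal {d : ℕ} (A : Matrix (Fin d) (Fin d) ℝ) (k : ℕ) : ℝ :=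
  sSup {r | ∃ V : Submodule ℝ (EuclideanSpace ℝ (Fin d)), Module.finrank ℝ V = k ∧
    r = sInf {s | ∃ x : EuclideanSpace ℝ (Fin d), x ∈ V ∧ ‖x‖ = 1 ∧
      s = ‖Matrix.toEuclideanLin A x‖}}

/-- the singular value function `φ^t` in `ℝ^d` -/
noncomputable def svf {d : ℕ} (A : Matrix (Fin d) (Fin d) ℝ) (t : ℝ) : ℝ :=
  if t < d then
    (∏ k ∈ Finset.range ⌊t⌋₊, singVal A (k + 1)) * singVal A (⌊t⌋₊ + 1) ^ (t - (⌊t⌋₊ : ℝ))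
  else |A.det| ^ (t / d)

/-- product of the matrices along a finite word -/
noncomputable def wprod {d κ : ℕ} (A : Fin κ → Matrix (Fin d) (Fin d) ℝ) (l : List (Fin κ)) :
    Matrix (Fin d) (Fin d) ℝ := (l.map A).prod

/-- the cylinder set `[li] ⊂ I^ℕ` of a finite word `li` -/
def cyl {κ : ℕ} (li : List (Fin κ)) : Set (ℕ → Fin κ) :=
  {x | ∀ k : Fin li.length, x k = li.get k}

open Module in
/-- In a right singular basis, `‖T x‖²` is the weighted sum of squared coordinates. -/
theorem LinearMap.exists_basis_norm_sq_eq_sum_singularValues {E F : Type*} [NormedAddCommGroup E]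
    [InnerProductSpace ℝ E] [FiniteDimensional ℝ E] [NormedAddCommGroup F] [InnerProductSpace ℝ F]
    [FiniteDimensional ℝ F] (T : E →ₗ[ℝ] F) :
    ∃ b : OrthonormalBasis (Fin (finrank ℝ E)) ℝ E, ∀ x,
      ‖T x‖ ^ 2 = ∑ i : Fin (finrank ℝ E), T.singularValues i ^ 2 * (b.repr x i) ^ 2 := by
  have hS := T.isSymmetric_adjoint_comp_self
  refine ⟨hS.eigenvectorBasis rfl, fun x => ?_⟩
  set b := hS.eigenvectorBasis rfl
  have h1 : ‖T x‖ ^ 2 = inner ℝ ((T.adjoint ∘ₗ T) x) x := by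
    rw [LinearMap.comp_apply, LinearMap.adjoint_inner_left, real_inner_self_eq_norm_sq]
  rw [h1, ← b.repr.inner_map_map, PiLp.inner_apply]
  refine Finset.sum_congr rfl fun i _ => ?_
  rw [hS.eigenvectorBasis_apply_self_apply rfl x i, T.sq_singularValues_fin rfl i]
  simp [b]
  ring

open Module in
theorem OrthonormalBasis.finrank_span_image {ι E : Type*} [Fintype ι] [NormedAddCommGroup E]
    [InnerProductSpace ℝ E] (b : OrthonormalBasis ι ℝ E) (s : Finset ι) :
    finrank ℝ (Submodule.span ℝ (b '' s)) = s.card := by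
  classical
  have h := b.orthonormal.linearIndependent
  rw [← Finset.coe_image, finrank_span_finset_eq_card, Finset.card_image_of_injective _ h.injective]
  have := (h.comp (Subtype.val : s → ι) Subtype.val_injective).linearIndepOn_id
  rw [Set.range_comp, Subtype.range_coe] at this
  rw [Finset.coe_image]
  exact this

theorem OrthonormalBasis.repr_eq_zero_of_mem_span_image {ι E : Type*} [Fintype ι]
    [NormedAddCommGroup E] [InnerProductSpace ℝ E] (b : OrthonormalBasis ι ℝ E) {s : Finset ι}
    {x : E} (hx : x ∈ Submodule.span ℝ (b '' s)) {i : ι} (hi : i ∉ s) : b.repr x i = 0 := by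
  have h : x ∈ Submodule.span ℝ (b.toBasis '' s) := by simpa using hx
  have h' := b.toBasis.mem_span_image.1 h
  by_contra hne
  exact hi (h' (by simpa using hne))

open Module in
/-- The nested spaces on which `T` expands by at least its leading singular values. -/
theorem LinearMap.exists_monotone_submodule_singularValues_le {E F : Type*} [NormedAddCommGroup E]
    [InnerProductSpace ℝ E] [FiniteDimensional ℝ E] [NormedAddCommGroup F] [InnerProductSpace ℝ F]
    [FiniteDimensional ℝ F] (T : E →ₗ[ℝ] F) :
    ∃ W : ℕ → Submodule ℝ E, Monotone W ∧ (∀ k ≤ finrank ℝ E, finrank ℝ (W k) = k) ∧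
      ∀ k, ∀ x ∈ W (k + 1), T.singularValues k * ‖x‖ ≤ ‖T x‖ := by
  obtain ⟨b, hb⟩ := T.exists_basis_norm_sq_eq_sum_singularValues
  refine ⟨fun k => Submodule.span ℝ
    (b '' ((Finset.univ.filter fun i : Fin (finrank ℝ E) => (i : ℕ) < k) : Finset _)),
    ?_, ?_, ?_⟩
  · intro k l hkl
    refine Submodule.span_mono (Set.image_mono ?_)
    intro i
    simp only [Finset.coe_filter, Finset.mem_univ, true_and, Set.mem_ofPred_eq]
    omega
  · intro k hk
    rw [b.finrank_span_image, Fin.card_filter_val_lt]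
    exact min_eq_right hk
  · intro k x hx
    refine (sq_le_sq₀ (mul_nonneg (T.singularValues_nonneg k) (norm_nonneg _))
      (norm_nonneg _)).1 ?_
    rw [mul_pow, hb, ← b.repr.norm_map x, EuclideanSpace.norm_sq_eq, Finset.mul_sum]
    refine Finset.sum_le_sum fun i _ => ?_
    by_cases hi : (i : ℕ) < k + 1
    · rw [Real.norm_eq_abs, sq_abs]
      have := T.singularValues_antitone (Nat.lt_succ_iff.1 hi)
      have := T.singularValues_nonneg k
      gcongr
    · rw [b.repr_eq_zero_of_mem_span_image hx (by simpa using hi)]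
      simp

open Module in
theorem LinearMap.exists_norm_le_singularValues {E F : Type*} [NormedAddCommGroup E]
    [InnerProductSpace ℝ E] [FiniteDimensional ℝ E] [NormedAddCommGroup F] [InnerProductSpace ℝ F]
    [FiniteDimensional ℝ F] (T : E →ₗ[ℝ] F) {k : ℕ} {W : Submodule ℝ E} (hW : k < finrank ℝ W) :
    ∃ x ∈ W, ‖x‖ = 1 ∧ ‖T x‖ ≤ T.singularValues k := by
  obtain ⟨b, hb⟩ := T.exists_basis_norm_sq_eq_sum_singularValues
  set V := Submodule.span ℝ
    (b '' ((Finset.univ.filter fun i : Fin (finrank ℝ E) => k ≤ (i : ℕ)) : Finset _)) with hV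
  have hWE : finrank ℝ W ≤ finrank ℝ E := Submodule.finrank_le W
  have hVd : finrank ℝ V = finrank ℝ E - k := by
    rw [hV, b.finrank_span_image]
    have := Finset.card_filter_add_card_filter_not (s := (Finset.univ : Finset (Fin (finrank ℝ E))))
      (fun i => (i : ℕ) < k)
    simp only [Fin.card_filter_val_lt, not_lt, Finset.card_univ, Fintype.card_fin] at this
    omega
  have hpos : 0 < finrank ℝ (W ⊓ V : Submodule ℝ E) := by
    have h1 := Submodule.finrank_sup_add_finrank_inf_eq W V
    have h2 := Submodule.finrank_le (W ⊔ V)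
    omega
  obtain ⟨⟨y, hy⟩, hy0⟩ := (finrank_pos_iff_exists_ne_zero).1 hpos
  have hy0' : y ≠ 0 := fun h => hy0 (by simpa using h)
  have hn : ‖y‖ ≠ 0 := norm_ne_zero_iff.2 hy0'
  have hxV : ‖y‖⁻¹ • y ∈ V := V.smul_mem _ hy.2
  refine ⟨‖y‖⁻¹ • y, W.smul_mem _ hy.1, by rw [norm_smul]; simp [hn], ?_⟩
  set x := ‖y‖⁻¹ • y with hx
  have hx1 : ‖x‖ = 1 := by rw [hx, norm_smul]; simp [hn]
  refine (sq_le_sq₀ (norm_nonneg _) (T.singularValues_nonneg k)).1 ?_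
  rw [← mul_one (T.singularValues k ^ 2), ← one_pow 2, ← hx1, hb, ← b.repr.norm_map x,
    EuclideanSpace.norm_sq_eq, Finset.mul_sum]
  refine Finset.sum_le_sum fun i _ => ?_
  by_cases hi : k ≤ (i : ℕ)
  · rw [Real.norm_eq_abs, sq_abs]
    have := T.singularValues_antitone hi
    have := T.singularValues_nonneg i
    gcongr
  · rw [b.repr_eq_zero_of_mem_span_image hxV (by simpa using hi)]
    simp

open Module in
theorem LinearMap.singularValues_domRestrict_le {E F : Type*} [NormedAddCommGroup E]
    [InnerProductSpace ℝ E] [FiniteDimensional ℝ E] [NormedAddCommGroup F] [InnerProductSpace ℝ F]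
    [FiniteDimensional ℝ F] (T : E →ₗ[ℝ] F) (U : Submodule ℝ E) (k : ℕ) :
    (T.domRestrict U).singularValues k ≤ T.singularValues k := by
  by_cases hk : k < finrank ℝ U
  · obtain ⟨W, -, hWd, hW⟩ := (T.domRestrict U).exists_monotone_submodule_singularValues_le
    have hd : finrank ℝ ((W (k + 1)).map U.subtype) = k + 1 := by
      rw [Submodule.finrank_map_subtype_eq, hWd _ hk]
    obtain ⟨x, hxW, hx1, hx⟩ := T.exists_norm_le_singularValues (k := k)
      (W := (W (k + 1)).map U.subtype) (by omega)
    obtain ⟨y, hy, rfl⟩ := hxW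
    have := hW k y hy
    have hy1 : ‖y‖ = 1 := hx1
    rw [hy1, mul_one] at this
    exact this.trans hx
  · rw [LinearMap.singularValues_of_finrank_le _ (not_lt.1 hk)]
    exact T.singularValues_nonneg k

open Module in
theorem LinearMap.normDet_domRestrict_le {E F : Type*} [NormedAddCommGroup E]
    [InnerProductSpace ℝ E] [FiniteDimensional ℝ E] [NormedAddCommGroup F] [InnerProductSpace ℝ F]
    [FiniteDimensional ℝ F] (T : E →ₗ[ℝ] F) (U : Submodule ℝ E) :
    (T.domRestrict U).normDet ≤ ∏ i ∈ Finset.range (finrank ℝ U), T.singularValues i := by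
  rw [LinearMap.normDet_eq_prod_singularValues]
  exact Finset.prod_le_prod (fun i _ => LinearMap.singularValues_nonneg _ i)
    fun i _ => T.singularValues_domRestrict_le U i

open Module in
theorem LinearMap.exists_prod_singularValues_le_normDet {E F : Type*} [NormedAddCommGroup E]
    [InnerProductSpace ℝ E] [FiniteDimensional ℝ E] [NormedAddCommGroup F] [InnerProductSpace ℝ F]
    [FiniteDimensional ℝ F] (T : E →ₗ[ℝ] F) {k : ℕ} (hk : k ≤ finrank ℝ E) :
    ∃ U : Submodule ℝ E, finrank ℝ U = k ∧
      ∏ i ∈ Finset.range k, T.singularValues i ≤ (T.domRestrict U).normDet := by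
  obtain ⟨W, hmono, hWd, hW⟩ := T.exists_monotone_submodule_singularValues_le
  refine ⟨W k, hWd k hk, ?_⟩
  rw [LinearMap.normDet_eq_prod_singularValues, hWd k hk]
  refine Finset.prod_le_prod (fun i _ => LinearMap.singularValues_nonneg _ i) fun i hi => ?_
  have hik : i + 1 ≤ k := Finset.mem_range.1 hi
  have hd : finrank ℝ ((W (i + 1)).submoduleOf (W k)) = i + 1 := by
    rw [(Submodule.submoduleOfEquivOfLe (hmono hik)).finrank_eq, hWd _ (hik.trans hk)]
  obtain ⟨x, hxW, hx1, hx⟩ := (T.domRestrict (W k)).exists_norm_le_singularValues (k := i)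
    (W := (W (i + 1)).submoduleOf (W k)) (by omega)
  have := hW i x hxW
  have hx1' : ‖(x : E)‖ = 1 := hx1
  rw [hx1', mul_one] at this
  exact this.trans hx

open Module in
/-- Submultiplicativity of the product of the `k` largest singular values. -/
theorem LinearMap.prod_singularValues_comp_le {E F G : Type*} [NormedAddCommGroup E]
    [InnerProductSpace ℝ E] [FiniteDimensional ℝ E] [NormedAddCommGroup F] [InnerProductSpace ℝ F]
    [FiniteDimensional ℝ F] [NormedAddCommGroup G] [InnerProductSpace ℝ G] [FiniteDimensional ℝ G]
    (S : F →ₗ[ℝ] G) (T : E →ₗ[ℝ] F) (hT : Function.Injective T) {k : ℕ} (hk : k ≤ finrank ℝ E) :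
    ∏ i ∈ Finset.range k, (S ∘ₗ T).singularValues i ≤
      (∏ i ∈ Finset.range k, S.singularValues i) * ∏ i ∈ Finset.range k, T.singularValues i := by
  obtain ⟨U, hU, hle⟩ := (S ∘ₗ T).exists_prod_singularValues_le_normDet hk
  have hcomp : (S ∘ₗ T).domRestrict U = S ∘ₗ T.domRestrict U := rfl
  have hr : finrank ℝ (T.domRestrict U).range = k := by
    rw [LinearMap.finrank_range_of_inj, hU]
    exact hT.comp Subtype.val_injective
  rw [hcomp, LinearMap.normDet_comp] at hle
  refine hle.trans (mul_le_mul ?_ ?_ (LinearMap.normDet_nonneg _)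
    (Finset.prod_nonneg fun i _ => S.singularValues_nonneg i))
  · simpa [hr] using S.normDet_domRestrict_le (T.domRestrict U).range
  · simpa [hU] using T.normDet_domRestrict_le U

theorem singVal_eq_singularValues {d : ℕ} (A : Matrix (Fin d) (Fin d) ℝ) {k : ℕ} (hk : k < d) :
    singVal A (k + 1) = (Matrix.toEuclideanLin A).singularValues k := by
  set T := Matrix.toEuclideanLin A
  have hbdd : ∀ V : Submodule ℝ (EuclideanSpace ℝ (Fin d)),
      BddBelow {s | ∃ x : EuclideanSpace ℝ (Fin d), x ∈ V ∧ ‖x‖ = 1 ∧ s = ‖T x‖} := fun V =>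
    ⟨0, by rintro _ ⟨x, -, -, rfl⟩; exact norm_nonneg _⟩
  have hub : ∀ r ∈ {r | ∃ V : Submodule ℝ (EuclideanSpace ℝ (Fin d)),
      Module.finrank ℝ V = k + 1 ∧ r = sInf {s | ∃ x : EuclideanSpace ℝ (Fin d),
        x ∈ V ∧ ‖x‖ = 1 ∧ s = ‖T x‖}}, r ≤ T.singularValues k := by
    rintro _ ⟨V, hV, rfl⟩
    obtain ⟨x, hxV, hx1, hx⟩ := T.exists_norm_le_singularValues (k := k) (W := V) (by omega)
    exact (csInf_le (hbdd V) ⟨x, hxV, hx1, rfl⟩).trans hx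
  obtain ⟨W, -, hWd, hW⟩ := T.exists_monotone_submodule_singularValues_le
  have hd : Module.finrank ℝ (W (k + 1)) = k + 1 := hWd _ (by simpa using hk)
  apply le_antisymm
  · exact csSup_le ⟨_, W (k + 1), hd, rfl⟩ hub
  · refine le_trans (le_csInf ?_ ?_) (le_csSup ⟨_, hub⟩ ⟨W (k + 1), hd, rfl⟩)
    · obtain ⟨x, hxV, hx1, -⟩ := T.exists_norm_le_singularValues (k := k) (W := W (k + 1))
        (by omega)
      exact ⟨_, x, hxV, hx1, rfl⟩
    · rintro _ ⟨x, hxV, hx1, rfl⟩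
      simpa [hx1] using hW k x hxV

section SubadditiveErgodic

variable {X : Type*}

/-- Greedy tiling bound for a nonpositive subadditive cocycle. -/
theorem subadditive_le_card_visits {T : X → X} {g : ℕ → X → ℝ} (hg0 : ∀ n x, g n x ≤ 0)
    (hsub : ∀ m n x, g (m + n) x ≤ g m x + g n (T^[m] x)) {c : ℝ} (hc : c ≤ 0) (N : ℕ) {E : Set X}
    (hE : ∀ x ∈ E, ∃ n, 1 ≤ n ∧ n ≤ N ∧ g n x ≤ c * n) (M : ℕ) (x : X) :
    g M x ≤ c * ∑ j ∈ Finset.range (M - N), E.indicator 1 (T^[j] x) := by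
  induction M using Nat.strong_induction_on generalizing x with
  | _ M ih =>
  have hind : ∀ y, E.indicator (1 : X → ℝ) y ≤ 1 := fun y =>
    Set.indicator_le' (fun _ _ => le_rfl) (fun _ _ => zero_le_one) y
  rcases le_or_gt M N with hMN | hMN
  · simpa [Nat.sub_eq_zero_of_le hMN] using hg0 M x
  by_cases hx : x ∈ E
  · obtain ⟨n, hn1, hnN, hgn⟩ := hE x hx
    have h1 := hsub n (M - n) x
    rw [Nat.add_sub_cancel' (by omega)] at h1
    have h2 := ih (M - n) (by omega) (T^[n] x)
    have h3 : ∑ j ∈ Finset.range (M - N), E.indicator (1 : X → ℝ) (T^[j] x) ≤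
        n + ∑ j ∈ Finset.range (M - n - N), E.indicator (1 : X → ℝ) (T^[j] (T^[n] x)) := by
      have h4 : ∑ j ∈ Finset.range (M - N), E.indicator (1 : X → ℝ) (T^[j] x) ≤
          ∑ j ∈ Finset.range (n + (M - n - N)), E.indicator (1 : X → ℝ) (T^[j] x) :=
        Finset.sum_le_sum_of_subset_of_nonneg (Finset.range_mono (by omega))
          fun _ _ _ => Set.indicator_nonneg (fun _ _ => zero_le_one) _
      rw [Finset.sum_range_add] at h4
      refine h4.trans (add_le_add ?_ (le_of_eq ?_))
      · exact (Finset.sum_le_sum fun j _ => hind _).trans (by simp)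
      · refine Finset.sum_congr rfl fun j _ => ?_
        rw [← Function.iterate_add_apply, Nat.add_comm]
    have h5 := mul_le_mul_of_nonpos_left h3 hc
    linarith
  · have h1 := hsub 1 (M - 1) x
    rw [Nat.add_sub_cancel' (by omega)] at h1
    have h2 := ih (M - 1) (by omega) (T^[1] x)
    have h0 := hg0 1 x
    obtain ⟨r, hr⟩ : ∃ r, M - N = r + 1 := ⟨M - N - 1, by omega⟩
    rw [hr, Finset.sum_range_succ']
    rw [show M - 1 - N = r by omega] at h2
    simp only [Function.iterate_zero, id, Set.indicator_of_notMem hx, add_zero]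
    simp only [← Function.iterate_add_apply] at h2
    linarith

theorem subadditive_mul_le_sum {T : X → X} {g : ℕ → X → ℝ} (hg0 : ∀ n x, g n x ≤ 0)
    (hsub : ∀ m n x, g (m + n) x ≤ g m x + g n (T^[m] x)) (m n : ℕ) (x : X) :
    m * g (n + m) x ≤ ∑ l ∈ Finset.range n, g m (T^[l] x) := by
  have hanti : Antitone fun n => g n x := antitone_nat_of_succ_le fun n => by
    have := hsub n 1 x
    have := hg0 1 (T^[n] x)
    linarith
  have h1 : ∀ n, ∑ r ∈ Finset.range m, g (n + r) x ≤ ∑ l ∈ Finset.range n, g m (T^[l] x) := by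
    intro n
    induction n with
    | zero => simpa using Finset.sum_nonpos fun r _ => hg0 (0 + r) x
    | succ n ih =>
      rw [Finset.sum_range_succ _ n]
      have h2 := Finset.sum_range_succ (fun r => g (n + r) x) m
      rw [Finset.sum_range_succ'] at h2
      have h3 : ∑ r ∈ Finset.range m, g (n + 1 + r) x = ∑ r ∈ Finset.range m, g (n + (r + 1)) x :=
        Finset.sum_congr rfl fun r _ => by rw [add_assoc, add_comm 1 r]
      have h4 := hsub n m x
      simp only [add_zero] at h2
      linarith
  refine le_trans ?_ (h1 n)
  have := Finset.card_nsmul_le_sum (Finset.range m) (fun r => g (n + r) x) (g (n + m) x)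
    fun r hr => hanti (by have := Finset.mem_range.1 hr; omega)
  simpa using this

variable [MeasurableSpace X] {μ : Measure X} {T : X → X}

theorem integral_birkhoffSum_eq (hT : MeasurePreserving T μ μ) {h : X → ℝ} (hm : Integrable h μ)
    (n : ℕ) : ∫ x, ∑ j ∈ Finset.range n, h (T^[j] x) ∂μ = n * ∫ x, h x ∂μ := by
  rw [integral_finsetSum]
  · rw [Finset.sum_congr rfl fun j _ => ?_, Finset.sum_const, Finset.card_range, nsmul_eq_mul]
    have hj := hT.iterate j
    have := integral_map (μ := μ) hj.measurable.aemeasurable (f := h)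
      (by rw [hj.map_eq]; exact hm.aestronglyMeasurable)
    rw [hj.map_eq] at this
    exact this.symm
  · intro j _
    exact (hT.iterate j).integrable_comp_of_integrable hm

variable [IsProbabilityMeasure μ]

theorem integrable_of_measurable_of_abs_le {h : X → ℝ} (hm : Measurable h) {C : ℝ}
    (hC : ∀ x, |h x| ≤ C) : Integrable h μ :=
  Integrable.of_bound hm.aestronglyMeasurable C (Eventually.of_forall hC)

/-- Lower half of the subadditive ergodic theorem. -/
theorem Ergodic.ae_eventually_le_subadditive (hT : Ergodic T μ) {g : ℕ → X → ℝ}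
    (hgm : ∀ n, Measurable (g n)) (hg0 : ∀ n x, g n x ≤ 0) {C : ℝ} (hC : ∀ n x, |g n x| ≤ C * n)
    (hsub : ∀ m n x, g (m + n) x ≤ g m x + g n (T^[m] x)) {L : ℝ}
    (hL : ∀ n, 1 ≤ n → L * n ≤ ∫ x, g n x ∂μ) {c : ℝ} (hc : c < L) :
    ∀ᵐ x ∂μ, ∀ᶠ n : ℕ in atTop, c * n ≤ g n x := by
  set B : Set X := {x | ∃ K : ℕ, ∃ᶠ n : ℕ in atTop, g n x ≤ c * n + K} with hB
  have hBm : MeasurableSet B := by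
    have : B = ⋃ K : ℕ, ⋂ a : ℕ, ⋃ b, ⋃ (_ : b ≥ a), {x | g b x ≤ c * b + K} := by
      ext; simp [hB, frequently_atTop]
    exact this ▸ MeasurableSet.iUnion fun K => MeasurableSet.iInter fun a =>
      MeasurableSet.iUnion fun b => MeasurableSet.iUnion fun _ =>
        measurableSet_le (hgm b) measurable_const
  have hBT : T ⁻¹' B ≤ᵐ[μ] B := by
    refine Eventually.of_forall fun x hx => ?_
    obtain ⟨K, hK⟩ : ∃ K : ℕ, ∃ᶠ n : ℕ in atTop, g n (T x) ≤ c * n + K := hx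
    obtain ⟨k, hk⟩ := exists_nat_ge (K - c)
    refine ⟨k, ?_⟩
    rw [frequently_atTop] at hK ⊢
    intro a
    obtain ⟨b, hba, hb⟩ := hK a
    refine ⟨1 + b, by omega, ?_⟩
    have h1 := hsub 1 b x
    have h2 := hg0 1 x
    simp only [Function.iterate_one] at h1
    push_cast
    linarith
  have hBnull : μ B = 0 := by
    rcases hT.ae_empty_or_univ_of_preimage_ae_le hBm.nullMeasurableSet hBT with h | h
    · simpa using measure_congr h
    exfalso
    obtain ⟨c', hc', hc'L⟩ := exists_between hc
    have hL0 : L ≤ 0 := by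
      have h1 := hL 1 le_rfl
      have h2 : ∫ x, g 1 x ∂μ ≤ 0 := integral_nonpos (hg0 1)
      push_cast at h1
      linarith
    have hc0 : c' ≤ 0 := by linarith
    set E : ℕ → Set X := fun N => {x | ∃ n, 1 ≤ n ∧ n ≤ N ∧ g n x ≤ c' * n} with hEdef
    have hEm : ∀ N, MeasurableSet (E N) := by
      intro N
      have : E N = ⋃ n, ⋃ (_ : 1 ≤ n ∧ n ≤ N), {x | g n x ≤ c' * n} := by
        ext; simp [E, and_assoc]
      exact this ▸ MeasurableSet.iUnion fun b => MeasurableSet.iUnion fun _ =>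
        measurableSet_le (hgm b) measurable_const
    have hEmono : Monotone E := by
      rintro N N' hNN' x ⟨n, h1, h2, h3⟩
      exact ⟨n, h1, h2.trans hNN', h3⟩
    have hBE : B ⊆ ⋃ N, E N := by
      rintro x ⟨K, hK⟩
      obtain ⟨k, hk⟩ := exists_nat_ge (K / (c' - c))
      obtain ⟨b, hb, hgb⟩ := frequently_atTop.1 hK (k + 1)
      refine Set.mem_iUnion.2 ⟨b, b, by omega, le_rfl, hgb.trans ?_⟩
      have h1 : (k : ℝ) ≤ b := by exact_mod_cast (by omega : k ≤ b)
      have h2 : K ≤ b * (c' - c) := by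
        rw [← div_le_iff₀ (by linarith)]
        exact hk.trans h1
      linarith
    have hlim : Tendsto (fun N => μ.real (E N)) atTop (nhds 1) := by
      have h1 := tendsto_measure_iUnion_atTop (μ := μ) hEmono
      have h2 : μ (⋃ N, E N) = 1 := by
        apply le_antisymm prob_le_one
        calc 1 = μ B := by rw [measure_congr h, measure_univ]
          _ ≤ _ := measure_mono hBE
      rw [h2] at h1
      exact (ENNReal.tendsto_toReal ENNReal.one_ne_top).comp h1
    have hkey : ∀ N, L ≤ c' * μ.real (E N) := by
      intro N
      have hM : ∀ M, N + 1 ≤ M → L * M ≤ c' * ((M - N : ℕ) * μ.real (E N)) := by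
        intro M hMN
        refine (hL M (by omega)).trans ?_
        have hi : Integrable ((E N).indicator (1 : X → ℝ)) μ :=
          (integrable_const (1 : ℝ)).indicator (hEm N)
        have h1 := integral_birkhoffSum_eq hT.toMeasurePreserving hi (M - N)
        rw [integral_indicator_one (hEm N)] at h1
        rw [← h1, ← integral_const_mul]
        refine integral_mono (integrable_of_measurable_of_abs_le (hgm M) (hC M)) ?_
          fun x => subadditive_le_card_visits hg0 hsub hc0 N (fun x hx => hx) M x
        refine (integrable_finsetSum _ fun j _ => ?_).const_mul c'
        exact (hT.toMeasurePreserving.iterate j).integrable_comp_of_integrable hi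
      have hlim2 : Tendsto (fun M : ℕ => c' * ((1 - N * (M : ℝ)⁻¹) * μ.real (E N))) atTop
          (nhds (c' * ((1 - N * 0) * μ.real (E N)))) :=
        (((tendsto_const_nhds (x := (N : ℝ))).mul tendsto_inv_atTop_nhds_zero_nat).const_sub
          1 |>.mul_const _).const_mul _
      have : L ≤ c' * ((1 - N * 0) * μ.real (E N)) := by
        refine ge_of_tendsto hlim2 ?_
        filter_upwards [eventually_ge_atTop (N + 1)] with M hMN
        have h1 := hM M hMN
        have hMpos : (0 : ℝ) < M := by exact_mod_cast (by omega : 0 < M)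
        rw [Nat.cast_sub (by omega)] at h1
        rw [← mul_le_mul_iff_left₀ hMpos]
        refine h1.trans (le_of_eq ?_)
        field_simp
      simpa using this
    have := ge_of_tendsto' (hlim.const_mul c') hkey
    linarith
  have hae : ∀ᵐ x ∂μ, x ∉ B := measure_eq_zero_iff_ae_notMem.1 hBnull
  filter_upwards [hae] with x hx
  by_contra hcon
  refine hx ⟨0, (not_eventually.1 hcon).mono fun n hn => ?_⟩
  simpa using (not_le.1 hn).le

theorem Ergodic.ae_tendsto_birkhoffSum_div (hT : Ergodic T μ) {h : X → ℝ} (hm : Measurable h)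
    {C : ℝ} (hC : ∀ x, |h x| ≤ C) :
    ∀ᵐ x ∂μ, Tendsto (fun n : ℕ => (∑ j ∈ Finset.range n, h (T^[j] x)) / n) atTop
      (nhds (∫ x, h x ∂μ)) := by
  have key : ∀ h : X → ℝ, Measurable h → (∀ x, |h x| ≤ C) → ∀ c < ∫ x, h x ∂μ,
      ∀ᵐ x ∂μ, ∀ᶠ n : ℕ in atTop, c * n ≤ ∑ j ∈ Finset.range n, h (T^[j] x) := by
    intro h hm hC c hc
    have hi : Integrable h μ := integrable_of_measurable_of_abs_le hm hC
    have := hT.ae_eventually_le_subadditive (C := 2 * C) (L := ∫ x, h x - C ∂μ) (c := c - C)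
      (g := fun n x => ∑ j ∈ Finset.range n, (h (T^[j] x) - C)) ?_ ?_ ?_ ?_ ?_ ?_
    · filter_upwards [this] with x hx
      filter_upwards [hx] with n hn
      simp only [Finset.sum_sub_distrib, Finset.sum_const, Finset.card_range, nsmul_eq_mul] at hn
      linarith
    · intro n
      refine Finset.measurable_sum _ fun j _ => ?_
      exact (hm.comp (hT.measurable.iterate j)).sub measurable_const
    · intro n x
      refine Finset.sum_nonpos fun j _ => ?_
      linarith [abs_le.1 (hC (T^[j] x))]
    · intro n x
      refine (Finset.abs_sum_le_sum_abs _ _).trans ?_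
      refine (Finset.sum_le_card_nsmul _ _ (2 * C) fun j _ => ?_).trans (by simp [mul_comm])
      have := abs_le.1 (hC (T^[j] x))
      rw [abs_le]
      constructor <;> linarith
    · intro m n x
      rw [Finset.sum_range_add]
      refine le_of_eq (congrArg₂ _ rfl (Finset.sum_congr rfl fun j _ => ?_))
      rw [← Function.iterate_add_apply, Nat.add_comm]
    · intro n _
      rw [integral_birkhoffSum_eq hT.toMeasurePreserving (h := fun x => h x - C)
        (hi.sub (integrable_const C)), mul_comm]
    · rw [integral_sub hi (integrable_const C)]
      simpa using hc
  have h1 : ∀ᵐ x ∂μ, ∀ k : ℕ, ∀ᶠ n : ℕ in atTop,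
      (∫ x, h x ∂μ - 1 / (k + 1)) * n ≤ ∑ j ∈ Finset.range n, h (T^[j] x) :=
    ae_all_iff.2 fun k => key h hm hC _ (sub_lt_self _ (by positivity))
  have h2 : ∀ᵐ x ∂μ, ∀ k : ℕ, ∀ᶠ n : ℕ in atTop,
      (∫ x, -h x ∂μ - 1 / (k + 1)) * n ≤ ∑ j ∈ Finset.range n, -h (T^[j] x) :=
    ae_all_iff.2 fun k => key (fun x => -h x) hm.neg (fun x => by simpa using hC x) _
      (sub_lt_self _ (by positivity))
  filter_upwards [h1, h2] with x hx1 hx2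
  rw [tendsto_order]
  constructor
  · intro a ha
    obtain ⟨k, hk⟩ := exists_nat_one_div_lt (sub_pos.2 ha)
    filter_upwards [hx1 k, eventually_gt_atTop 0] with n hn hn0
    have hn0' : (0 : ℝ) < n := by exact_mod_cast hn0
    rw [lt_div_iff₀ hn0']
    refine lt_of_lt_of_le ?_ hn
    gcongr
    linarith
  · intro a ha
    obtain ⟨k, hk⟩ := exists_nat_one_div_lt (sub_pos.2 ha)
    filter_upwards [hx2 k, eventually_gt_atTop 0] with n hn hn0
    have hn0' : (0 : ℝ) < n := by exact_mod_cast hn0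
    rw [div_lt_iff₀ hn0']
    rw [integral_neg, Finset.sum_neg_distrib] at hn
    have : (∫ x, h x ∂μ + 1 / (k + 1)) * n < a * n := by
      gcongr
      linarith
    linarith

/-- Kingman's subadditive ergodic theorem for bounded cocycles over an ergodic system. -/
theorem Ergodic.ae_tendsto_subadditive_div (hT : Ergodic T μ) {f : ℕ → X → ℝ}
    (hfm : ∀ n, Measurable (f n)) {C : ℝ} (hC : ∀ n x, |f n x| ≤ C * n)
    (hsub : ∀ m n x, f (m + n) x ≤ f m x + f n (T^[m] x)) :
    ∃ L : ℝ, ∀ᵐ x ∂μ, Tendsto (fun n : ℕ => f n x / n) atTop (nhds L) := by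
  set g : ℕ → X → ℝ := fun n x => f n x - C * n with hg
  have hgm : ∀ n, Measurable (g n) := fun n => (hfm n).sub measurable_const
  have hg0 : ∀ n x, g n x ≤ 0 := fun n x => by
    have := abs_le.1 (hC n x)
    simp only [hg]
    linarith
  have hgC : ∀ n x, |g n x| ≤ 2 * C * n := fun n x => by
    have := abs_le.1 (hC n x)
    rw [abs_le]
    simp only [hg]
    constructor <;> linarith
  have hgsub : ∀ m n x, g (m + n) x ≤ g m x + g n (T^[m] x) := fun m n x => by
    have := hsub m n x
    simp only [hg]
    push_cast
    linarith
  set a : ℕ → ℝ := fun n => (∫ x, g (n + 1) x ∂μ) / (n + 1 : ℕ) with ha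
  have hbdd : BddBelow (Set.range a) := by
    refine ⟨-(2 * C), ?_⟩
    rintro _ ⟨n, rfl⟩
    have hn : (0 : ℝ) < (n + 1 : ℕ) := by positivity
    rw [ha]
    simp only
    rw [le_div_iff₀ hn]
    have h1 : ∫ _, -(2 * C) * (n + 1 : ℕ) ∂μ ≤ ∫ x, g (n + 1) x ∂μ :=
      integral_mono (integrable_const _) (integrable_of_measurable_of_abs_le (hgm _) (hgC _))
        fun x => by have := abs_le.1 (hgC (n + 1) x); linarith
    simpa using h1
  have hL : ∀ n, 1 ≤ n → (⨅ n, a n) * n ≤ ∫ x, g n x ∂μ := by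
    intro n hn
    obtain ⟨r, rfl⟩ := Nat.exists_eq_add_of_le' hn
    rw [← le_div_iff₀ (by positivity)]
    exact ciInf_le hbdd r
  have h1 : ∀ᵐ x ∂μ, ∀ k : ℕ, ∀ᶠ n : ℕ in atTop, ((⨅ n, a n) - 1 / (k + 1)) * n ≤ g n x :=
    ae_all_iff.2 fun k => hT.ae_eventually_le_subadditive hgm hg0 hgC hgsub hL
      (sub_lt_self _ (by positivity))
  have h2 : ∀ᵐ x ∂μ, ∀ m : ℕ, Tendsto (fun n : ℕ => (∑ j ∈ Finset.range n, g m (T^[j] x)) / n)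
      atTop (nhds (∫ x, g m x ∂μ)) :=
    ae_all_iff.2 fun m => hT.ae_tendsto_birkhoffSum_div (hgm m) (hgC m)
  refine ⟨(⨅ n, a n) + C, ?_⟩
  filter_upwards [h1, h2] with x hx1 hx2
  have hlim : Tendsto (fun n : ℕ => g n x / n) atTop (nhds (⨅ n, a n)) := by
    rw [tendsto_order]
    constructor
    · intro c hc
      obtain ⟨k, hk⟩ := exists_nat_one_div_lt (sub_pos.2 hc)
      filter_upwards [hx1 k, eventually_gt_atTop 0] with n hn hn0
      have hn0' : (0 : ℝ) < n := by exact_mod_cast hn0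
      rw [lt_div_iff₀ hn0']
      refine lt_of_lt_of_le ?_ hn
      gcongr
      linarith
    · intro c hc
      obtain ⟨r, hr⟩ := exists_lt_of_ciInf_lt hc
      set m := r + 1 with hm
      have hmpos : (0 : ℝ) < m := by positivity
      have hlim1 : Tendsto (fun n : ℕ => ((∑ j ∈ Finset.range n, g m (T^[j] x)) / n) *
          ((n : ℝ) / (n + m)) / m) atTop (nhds ((∫ x, g m x ∂μ) * 1 / m)) :=
        ((hx2 m).mul (tendsto_natCast_div_add_atTop (m : ℝ))).div_const _
      rw [mul_one] at hlim1
      rw [← eventually_map (m := fun n : ℕ => g n x / n) (P := fun y => y < c),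
        ← map_add_atTop_eq_nat m, Filter.map_map, eventually_map]
      filter_upwards [hlim1.eventually (gt_mem_nhds hr), eventually_gt_atTop 0] with n hn hn0
      have hn0' : (0 : ℝ) < n := by exact_mod_cast hn0
      refine lt_of_le_of_lt ?_ hn
      have h3 := subadditive_mul_le_sum hg0 hgsub m n x
      simp only [Function.comp_apply]
      push_cast
      rw [div_mul_div_cancel₀ hn0'.ne', div_div, div_le_div_iff₀ (by positivity) (by positivity)]
      have : (0 : ℝ) < n + m := by positivity
      nlinarith
  refine (hlim.add_const C).congr' ?_
  filter_upwards [eventually_gt_atTop 0] with n hn0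
  have hn0' : (n : ℝ) ≠ 0 := by exact_mod_cast hn0.ne'
  simp only [hg]
  field_simp
  ring

end SubadditiveErgodic

section ShiftSpace

variable {κ : ℕ}

/-- The left shift on one-sided sequences. -/
def seqShift (x : ℕ → Fin κ) : ℕ → Fin κ := fun n => x (n + 1)

theorem seqShift_iterate (k : ℕ) (x : ℕ → Fin κ) (n : ℕ) : seqShift^[k] x n = x (k + n) := by
  induction k generalizing x with
  | zero => simp
  | succ k ih =>
    rw [Function.iterate_succ_apply, ih, seqShift]
    congr 1
    omega

theorem continuous_seqShift : Continuous (seqShift (κ := κ)) :=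
  continuous_pi fun n => continuous_apply (n + 1)

theorem measurable_seqShift : Measurable (seqShift (κ := κ)) :=
  measurable_pi_lambda _ fun n => measurable_pi_apply (n + 1)

/-- The initial word of length `n`. -/
def seqInit (n : ℕ) (x : ℕ → Fin κ) : Fin n → Fin κ := fun j => x j

theorem continuous_seqInit (n : ℕ) : Continuous (seqInit (κ := κ) n) :=
  continuous_pi fun j => continuous_apply (j : ℕ)

theorem measurable_seqInit (n : ℕ) : Measurable (seqInit (κ := κ) n) :=
  measurable_pi_lambda _ fun j => measurable_pi_apply (j : ℕ)

theorem mem_cyl_iff {u : List (Fin κ)} {x : ℕ → Fin κ} :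
    x ∈ cyl u ↔ ∀ k (h : k < u.length), x k = u[k] :=
  ⟨fun h k hk => h ⟨k, hk⟩, fun h k => h k k.2⟩

theorem mem_cyl_append {u v : List (Fin κ)} {x : ℕ → Fin κ} :
    x ∈ cyl (u ++ v) ↔ x ∈ cyl u ∧ seqShift^[u.length] x ∈ cyl v := by
  simp only [mem_cyl_iff, seqShift_iterate, List.length_append]
  constructor
  · intro h
    refine ⟨fun k hk => ?_, fun k hk => ?_⟩
    · rw [h k (by omega), List.getElem_append_left]
    · rw [h (u.length + k) (by omega), List.getElem_append_right (by omega)]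
      simp
  · rintro ⟨h1, h2⟩ k hk
    by_cases hku : k < u.length
    · rw [h1 k hku, List.getElem_append_left]
    · obtain ⟨r, rfl⟩ := Nat.exists_eq_add_of_le (not_lt.1 hku)
      rw [h2 r (by omega), List.getElem_append_right (by omega)]
      simp

theorem cyl_ofFn {n : ℕ} (a : Fin n → Fin κ) : cyl (List.ofFn a) = seqInit n ⁻¹' {a} := by
  ext x
  simp only [mem_cyl_iff, List.length_ofFn, List.getElem_ofFn, Set.mem_preimage,
    Set.mem_singleton_iff, funext_iff, seqInit]
  exact ⟨fun h j => h j j.2, fun h k hk => h ⟨k, hk⟩⟩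

theorem cyl_eq_preimage (u : List (Fin κ)) : cyl u = seqInit u.length ⁻¹' {u.get} := by
  conv_lhs => rw [← List.ofFn_get u]
  exact cyl_ofFn u.get

theorem isClopen_cyl (u : List (Fin κ)) : IsClopen (cyl u) := by
  rw [cyl_eq_preimage]
  exact (isClopen_discrete _).preimage (continuous_seqInit _)

theorem measurableSet_cyl (u : List (Fin κ)) : MeasurableSet (cyl u) :=
  (isClopen_cyl u).isOpen.measurableSet

theorem measureReal_cyl_inter (μ : Measure (ℕ → Fin κ)) [IsFiniteMeasure μ] (u v : List (Fin κ))
    (k : ℕ) : μ.real (cyl u ∩ seqShift^[u.length + k] ⁻¹' cyl v) =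
      ∑ a : Fin k → Fin κ, μ.real (cyl (u ++ (List.ofFn a ++ v))) := by
  set S := cyl u ∩ seqShift^[u.length + k] ⁻¹' cyl v
  have hS : MeasurableSet S :=
    (measurableSet_cyl u).inter ((measurable_seqShift.iterate _) (measurableSet_cyl v))
  have hm : Measurable fun x : ℕ → Fin κ => seqInit k (seqShift^[u.length] x) :=
    (measurable_seqInit k).comp (measurable_seqShift.iterate _)
  have h := sum_measureReal_preimage_singleton (μ := μ.restrict S)
    (Finset.univ : Finset (Fin k → Fin κ)) (f := fun x => seqInit k (seqShift^[u.length] x))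
    (fun y _ => hm (measurableSet_singleton y))
  rw [Finset.coe_univ, Set.preimage_univ, measureReal_restrict_apply MeasurableSet.univ,
    Set.univ_inter] at h
  rw [← h]
  refine Finset.sum_congr rfl fun a _ => ?_
  rw [measureReal_restrict_apply (hm (measurableSet_singleton a))]
  congr 1
  ext x
  rw [mem_cyl_append, mem_cyl_append, cyl_ofFn, List.length_ofFn, ← Function.iterate_add_apply,
    Nat.add_comm k]
  simp only [S, Set.mem_inter_iff, Set.mem_preimage]
  tauto

theorem sum_wordWeight_add (F : List (Fin κ) → ℝ) (m n : ℕ) :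
    ∑ a : Fin (m + n) → Fin κ, F (List.ofFn a) =
      ∑ a : Fin m → Fin κ, ∑ b : Fin n → Fin κ, F (List.ofFn a ++ List.ofFn b) := by
  rw [← Fintype.sum_prod_type', ← (Fin.appendEquiv m n).sum_comp]
  refine Finset.sum_congr rfl fun x _ => ?_
  rw [← List.ofFn_fin_append]
  rfl

theorem isSetAlgebra_seqInit :
    IsSetAlgebra {C : Set (ℕ → Fin κ) | ∃ n, ∃ S : Set (Fin n → Fin κ), C = seqInit n ⁻¹' S} where
  empty_mem := ⟨0, ∅, by simp⟩
  compl_mem := by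
    rintro _ ⟨n, S, rfl⟩
    exact ⟨n, Sᶜ, rfl⟩
  union_mem := by
    rintro _ _ ⟨n, S, rfl⟩ ⟨m, S', rfl⟩
    exact ⟨max n m,
      (fun (a : Fin (max n m) → Fin κ) (j : Fin n) =>
        a ⟨j, j.2.trans_le (le_max_left _ _)⟩) ⁻¹' S ∪
      (fun (a : Fin (max n m) → Fin κ) (j : Fin m) =>
        a ⟨j, j.2.trans_le (le_max_right _ _)⟩) ⁻¹' S', rfl⟩

theorem generateFrom_seqInit : (inferInstance : MeasurableSpace (ℕ → Fin κ)) =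
    MeasurableSpace.generateFrom
      {C : Set (ℕ → Fin κ) | ∃ n, ∃ S : Set (Fin n → Fin κ), C = seqInit n ⁻¹' S} := by
  apply le_antisymm
  · refine iSup_le fun i => ?_
    rintro _ ⟨s, -, rfl⟩
    exact MeasurableSpace.measurableSet_generateFrom
      ⟨i + 1, (fun a => a (Fin.last i)) ⁻¹' s, rfl⟩
  · refine MeasurableSpace.generateFrom_le ?_
    rintro _ ⟨n, S, rfl⟩
    exact measurable_seqInit n (MeasurableSet.of_discrete (s := S))

theorem measureReal_seqInit_preimage (μ : Measure (ℕ → Fin κ)) [IsFiniteMeasure μ] (n : ℕ)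
    (S : Finset (Fin n → Fin κ)) :
    μ.real (seqInit n ⁻¹' S) = ∑ a ∈ S, μ.real (cyl (List.ofFn a)) := by
  rw [← sum_measureReal_preimage_singleton S
    fun y _ => measurable_seqInit n (measurableSet_singleton y)]
  simp only [cyl_ofFn]

theorem isPiSystem_of_isSetAlgebra {X : Type*} {𝒜 : Set (Set X)} (h : IsSetAlgebra 𝒜) :
    IsPiSystem 𝒜 := fun _ hs _ ht _ => h.inter_mem hs ht

theorem measurePreserving_seqShift_of_clopen {μ : Measure (ℕ → Fin κ)} [IsProbabilityMeasure μ]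
    (h : ∀ C, IsClopen C → μ.real (seqShift ⁻¹' C) = μ.real C) :
    MeasurePreserving seqShift μ μ := by
  refine ⟨measurable_seqShift, ?_⟩
  have : IsProbabilityMeasure (μ.map seqShift) :=
    Measure.isProbabilityMeasure_map measurable_seqShift.aemeasurable
  refine ext_of_generate_finite _ generateFrom_seqInit
    (isPiSystem_of_isSetAlgebra isSetAlgebra_seqInit) ?_ (by simp)
  rintro _ ⟨n, S, rfl⟩
  have hS : IsClopen (seqInit (κ := κ) n ⁻¹' S) :=
    (isClopen_discrete S).preimage (continuous_seqInit n)
  rw [Measure.map_apply measurable_seqShift hS.isOpen.measurableSet]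
  have := h _ hS
  rwa [measureReal_eq_measureReal_iff] at this

/-- A shift-invariant measure with the lower quasi-Bernoulli property is ergodic. -/
theorem ergodic_seqShift_of_quasiBernoulli {μ : Measure (ℕ → Fin κ)} [IsProbabilityMeasure μ]
    (hT : MeasurePreserving seqShift μ μ) {K : ℝ} (hK : 0 < K)
    (h : ∀ u v : List (Fin κ), K * μ.real (cyl u) * μ.real (cyl v) ≤ μ.real (cyl (u ++ v))) :
    Ergodic seqShift μ := by
  classical
  refine ⟨hT, ⟨fun B hB hBT => ?_⟩⟩
  have hBn : ∀ n, seqShift^[n] ⁻¹' B = B := fun n => by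
    rw [Set.preimage_iterate_eq]
    exact Function.iterate_fixed hBT n
  have hcyl : ∀ (n : ℕ) (S S' : Set (Fin n → Fin κ)),
      K * μ.real (seqInit n ⁻¹' S) * μ.real (seqInit n ⁻¹' S') ≤
        μ.real (seqInit n ⁻¹' S ∩ seqShift^[n] ⁻¹' (seqInit n ⁻¹' S')) := by
    intro n S S'
    have hm : Measurable fun x : ℕ → Fin κ => (seqInit n x, seqInit n (seqShift^[n] x)) :=
      (measurable_seqInit n).prodMk ((measurable_seqInit n).comp (measurable_seqShift.iterate n))
    have h1 := sum_measureReal_preimage_singleton (μ := μ) (S.toFinset ×ˢ S'.toFinset)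
      (f := fun x => (seqInit n x, seqInit n (seqShift^[n] x)))
      (fun y _ => hm (measurableSet_singleton y))
    have h2 : seqInit n ⁻¹' S ∩ seqShift^[n] ⁻¹' (seqInit n ⁻¹' S') =
        (fun x : ℕ → Fin κ => (seqInit n x, seqInit n (seqShift^[n] x))) ⁻¹'
          ((S.toFinset ×ˢ S'.toFinset : Finset _) : Set _) := by
      ext x; simp
    rw [h2, ← h1, Finset.sum_product]
    have h3 := measureReal_seqInit_preimage μ n S.toFinset
    have h4 := measureReal_seqInit_preimage μ n S'.toFinset
    rw [Set.coe_toFinset] at h3 h4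
    rw [h3, h4, mul_assoc, Finset.sum_mul_sum, Finset.mul_sum]
    refine Finset.sum_le_sum fun a _ => ?_
    rw [Finset.mul_sum]
    refine Finset.sum_le_sum fun b _ => ?_
    rw [← mul_assoc]
    refine (h _ _).trans (le_of_eq ?_)
    congr 1
    ext x
    rw [mem_cyl_append, cyl_ofFn, cyl_ofFn, List.length_ofFn]
    simp [Prod.ext_iff]
  have hprod : μ.real B * (1 - μ.real B) ≤ 0 := by
    refine le_of_forall_pos_le_add fun δ hδ => ?_
    obtain ⟨_, ⟨n, S, rfl⟩, hC⟩ := ((Measure.MeasureDense.of_generateFrom_isSetAlgebra_finite μ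
      isSetAlgebra_seqInit generateFrom_seqInit).approx B hB (measure_ne_top _ _)
      (δ / (2 / K + 1)) (by positivity))
    set ε := δ / (2 / K + 1) with hε
    set C := seqInit (κ := κ) n ⁻¹' S
    have hCm : MeasurableSet C := measurable_seqInit n (MeasurableSet.of_discrete (s := S))
    have hC' : μ.real (symmDiff B C) < ε := by
      rw [measureReal_def]
      exact ENNReal.toReal_lt_of_lt_ofReal hC
    have h1 : K * μ.real Cᶜ * μ.real C ≤ 2 * ε := by
      refine (hcyl n Sᶜ S).trans ?_
      have hsub : seqInit n ⁻¹' Sᶜ ∩ seqShift^[n] ⁻¹' C ⊆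
          symmDiff B C ∪ seqShift^[n] ⁻¹' symmDiff B C := by
        rintro x ⟨hx1, hx2⟩
        have hx3 : x ∈ B ↔ seqShift^[n] x ∈ B := by
          conv_lhs => rw [← hBn n]
          rfl
        have hx1' : x ∉ C := hx1
        have hx2' : seqShift^[n] x ∈ C := hx2
        simp only [Set.mem_union, Set.mem_preimage, Set.mem_symmDiff]
        tauto
      have h5 : μ.real (seqShift^[n] ⁻¹' symmDiff B C) = μ.real (symmDiff B C) := by
        rw [measureReal_def, (hT.iterate n).measure_preimage (hB.symmDiff hCm).nullMeasurableSet]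
        rfl
      have := (measureReal_mono hsub).trans (measureReal_union_le _ _)
      linarith
    rw [probReal_compl_eq_one_sub hCm] at h1
    have h6 : |μ.real B - μ.real C| ≤ ε :=
      (abs_measureReal_sub_le_measureReal_symmDiff hB.nullMeasurableSet
        hCm.nullMeasurableSet).trans hC'.le
    have h7 : (1 - μ.real C) * μ.real C ≤ 2 / K * ε := by
      rw [div_mul_eq_mul_div, le_div_iff₀ hK]
      linarith
    have h8 : δ = 2 / K * ε + ε := by
      rw [hε]
      field_simp
    have h9 : μ.real B * (1 - μ.real B) - (1 - μ.real C) * μ.real C ≤ ε := by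
      have e1 : μ.real B * (1 - μ.real B) - (1 - μ.real C) * μ.real C =
        (μ.real B - μ.real C) * (1 - μ.real B - μ.real C) := by ring
      rw [e1]
      refine (le_abs_self _).trans ?_
      rw [abs_mul]
      have : |1 - μ.real B - μ.real C| ≤ 1 := by
        rw [abs_le]
        have a1 := measureReal_nonneg (μ := μ) (s := B)
        have a2 := measureReal_nonneg (μ := μ) (s := C)
        have a3 := measureReal_le_one (μ := μ) (s := B)
        have a4 := measureReal_le_one (μ := μ) (s := C)
        constructor <;> linarith
      calc _ ≤ ε * 1 := mul_le_mul h6 this (abs_nonneg _) ((abs_nonneg _).trans h6)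
        _ = ε := mul_one _
    linarith
  rw [eventuallyConst_set']
  have a1 := measureReal_nonneg (μ := μ) (s := B)
  have a3 := measureReal_le_one (μ := μ) (s := B)
  rcases mul_eq_zero.1 (le_antisymm hprod (mul_nonneg a1 (by linarith))) with h0 | h0
  · left
    rw [ae_eq_empty]
    exact (measureReal_eq_zero_iff).1 h0
  · right
    rw [ae_eq_univ]
    rw [← probReal_compl_eq_one_sub hB] at h0
    exact (measureReal_eq_zero_iff).1 h0

end ShiftSpace

section GibbsMeasure

variable {κ : ℕ}

theorem Subadditive.mul_le_of_tendsto {u : ℕ → ℝ} (hu : Subadditive u) {P : ℝ}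
    (hP : Tendsto (fun n => u n / n) atTop (nhds P)) (n : ℕ) : n * P ≤ u n := by
  rcases Nat.eq_zero_or_pos n with rfl | hn
  · have := hu 0 0
    simp only [add_zero, CharP.cast_eq_zero, zero_mul] at this ⊢
    linarith
  · have hb := hP.bddBelow_range
    have h := hu.lim_le_div hb hn.ne'
    rw [tendsto_nhds_unique (hu.tendsto_lim hb) hP, le_div_iff₀ (by positivity)] at h
    linarith

theorem exp_mul_le_of_tendsto_log {s : ℕ → ℝ} (hs : ∀ n, 0 < s n)
    (h : ∀ m n, s (m + n) ≤ s m * s n) {P : ℝ}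
    (hP : Tendsto (fun n : ℕ => (n : ℝ)⁻¹ * Real.log (s n)) atTop (nhds P)) (n : ℕ) :
    Real.exp (n * P) ≤ s n := by
  rw [← Real.le_log_iff_exp_le (hs n)]
  refine Subadditive.mul_le_of_tendsto (u := fun n => Real.log (s n)) (fun m n => ?_) ?_ n
  · rw [← Real.log_mul (hs m).ne' (hs n).ne']
    exact Real.log_le_log (hs _) (h m n)
  · simpa only [div_eq_inv_mul] using hP

theorem le_mul_exp_of_tendsto_log {s : ℕ → ℝ} (hs : ∀ n, 0 < s n) {D : ℝ} (hD : 0 < D)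
    (h : ∀ m n, D⁻¹ * s m * s n ≤ s (m + n)) {P : ℝ}
    (hP : Tendsto (fun n : ℕ => (n : ℝ)⁻¹ * Real.log (s n)) atTop (nhds P)) (n : ℕ) :
    s n ≤ D * Real.exp (n * P) := by
  have key := exp_mul_le_of_tendsto_log (s := fun n => D / s n) (P := -P)
    (fun n => div_pos hD (hs n)) (fun m n => ?_) ?_ n
  · rw [mul_neg, Real.exp_neg, le_div_iff₀ (hs n), inv_mul_le_iff₀ (Real.exp_pos _)] at key
    linarith
  · rw [div_mul_div_comm, div_le_div_iff₀ (hs _) (mul_pos (hs m) (hs n))]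
    have := mul_le_mul_of_nonneg_left (h m n) (mul_pos hD hD).le
    calc D * (s m * s n) = D * D * (D⁻¹ * s m * s n) := by field_simp
      _ ≤ _ := this
  · have : Tendsto (fun n : ℕ => (n : ℝ)⁻¹ * Real.log D - (n : ℝ)⁻¹ * Real.log (s n)) atTop
        (nhds (0 * Real.log D - P)) :=
      ((tendsto_inv_atTop_nhds_zero_nat (𝕜 := ℝ)).mul_const _).sub hP
    rw [zero_mul, zero_sub] at this
    refine this.congr fun n => ?_
    rw [Real.log_div hD.ne' (hs n).ne', mul_sub]

theorem MeasureTheory.ProbabilityMeasure.exists_convexCombination {ι E : Type*} [Fintype ι]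
    [MeasurableSpace E] {w : ι → ℝ} (hw : ∀ i, 0 ≤ w i) (hw1 : ∑ i, w i = 1)
    (p : ι → ProbabilityMeasure E) :
    ∃ μ : ProbabilityMeasure E, ∀ C : Set E,
      (μ : Measure E).real C = ∑ i, w i * (p i : Measure E).real C := by
  have key : ∀ C : Set E, (∑ i, ENNReal.ofReal (w i) • (p i : Measure E)) C =
      ENNReal.ofReal (∑ i, w i * (p i : Measure E).real C) := by
    intro C
    rw [Measure.finsetSum_apply, ENNReal.ofReal_sum_of_nonneg
      fun i _ => mul_nonneg (hw i) measureReal_nonneg]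
    refine Finset.sum_congr rfl fun i _ => ?_
    rw [ENNReal.ofReal_mul (hw i), ofReal_measureReal, Measure.smul_apply, smul_eq_mul]
  refine ⟨⟨∑ i, ENNReal.ofReal (w i) • (p i : Measure E), ⟨?_⟩⟩, fun C => ?_⟩
  · rw [key]
    simp [hw1]
  · rw [measureReal_def, ProbabilityMeasure.coe_mk, key, ENNReal.toReal_ofReal
      (Finset.sum_nonneg fun i _ => mul_nonneg (hw i) measureReal_nonneg)]

theorem exists_tendsto_measureReal_clopen (m : ℕ → ProbabilityMeasure (ℕ → Fin κ)) :
    ∃ l : Filter ℕ, l.NeBot ∧ l ≤ atTop ∧ ∃ μ : ProbabilityMeasure (ℕ → Fin κ), ∀ C, IsClopen C →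
      Tendsto (fun n => (m n : Measure (ℕ → Fin κ)).real C) l
        (nhds ((μ : Measure (ℕ → Fin κ)).real C)) := by
  let F : Ultrafilter (ProbabilityMeasure (ℕ → Fin κ)) := (hyperfilter ℕ).map m
  obtain ⟨μ, -, hμ⟩ := isCompact_univ.ultrafilter_le_nhds F (by simp)
  refine ⟨hyperfilter ℕ, inferInstance, Nat.hyperfilter_le_atTop, μ, fun C hC => ?_⟩
  have h : Tendsto m (hyperfilter ℕ : Filter ℕ) (nhds μ) := hμ
  exact (ENNReal.tendsto_toReal (measure_ne_top _ _)).comp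
    (ProbabilityMeasure.tendsto_measure_of_null_frontier_of_tendsto' h (by simp [hC.frontier_eq]))

/-- Extension of a finite word to an infinite one. -/
def wordExtend (i₀ : Fin κ) (l : List (Fin κ)) : ℕ → Fin κ := fun n => l.getD n i₀

theorem wordExtend_append_mem_cyl (i₀ : Fin κ) {u w : List (Fin κ)} (h : w.length = u.length)
    (v : List (Fin κ)) : wordExtend i₀ (w ++ v) ∈ cyl u ↔ w = u := by
  rw [mem_cyl_iff]
  have key : ∀ k (hk : k < u.length), wordExtend i₀ (w ++ v) k = w[k] := by
    intro k hk
    rw [wordExtend, List.getD_append _ _ _ _ (by omega), List.getD_eq_getElem]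
  constructor
  · intro H
    refine List.ext_getElem h fun k _ hk => ?_
    rw [← H k hk, key k hk]
  · rintro rfl k hk
    exact key k hk

theorem sum_wordWeight_append_bounds {φ : List (Fin κ) → ℝ} {D : ℝ}
    (hle : ∀ u v, φ (u ++ v) ≤ φ u * φ v) (hge : ∀ u v, D⁻¹ * φ u * φ v ≤ φ (u ++ v))
    (u : List (Fin κ)) (n : ℕ) :
    (D⁻¹ * φ u * ∑ a : Fin n → Fin κ, φ (List.ofFn a) ≤
        ∑ a : Fin n → Fin κ, φ (u ++ List.ofFn a) ∧
      ∑ a : Fin n → Fin κ, φ (u ++ List.ofFn a) ≤ φ u * ∑ a : Fin n → Fin κ, φ (List.ofFn a)) ∧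
    (D⁻¹ * (∑ a : Fin n → Fin κ, φ (List.ofFn a)) * φ u ≤
        ∑ a : Fin n → Fin κ, φ (List.ofFn a ++ u) ∧
      ∑ a : Fin n → Fin κ, φ (List.ofFn a ++ u) ≤
        (∑ a : Fin n → Fin κ, φ (List.ofFn a)) * φ u) := by
  refine ⟨⟨?_, ?_⟩, ?_, ?_⟩
  · rw [Finset.mul_sum]
    exact Finset.sum_le_sum fun a _ => hge _ _
  · rw [Finset.mul_sum]
    exact Finset.sum_le_sum fun a _ => hle _ _
  · rw [Finset.mul_sum, Finset.sum_mul]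
    exact Finset.sum_le_sum fun a _ => hge _ _
  · rw [Finset.sum_mul]
    exact Finset.sum_le_sum fun a _ => hle _ _

theorem exp_le_sum_wordWeight_le {φ : List (Fin κ) → ℝ} {D P : ℝ} (hκ : 0 < κ) (hD : 0 < D)
    (hpos : ∀ u, 0 < φ u)
    (hle : ∀ u v, φ (u ++ v) ≤ φ u * φ v) (hge : ∀ u v, D⁻¹ * φ u * φ v ≤ φ (u ++ v))
    (hP : Tendsto (fun n : ℕ => (n : ℝ)⁻¹ * Real.log (∑ a : Fin n → Fin κ, φ (List.ofFn a)))
      atTop (nhds P)) (n : ℕ) :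
    Real.exp (n * P) ≤ ∑ a : Fin n → Fin κ, φ (List.ofFn a) ∧
      ∑ a : Fin n → Fin κ, φ (List.ofFn a) ≤ D * Real.exp (n * P) := by
  have : Nonempty (Fin κ) := ⟨⟨0, hκ⟩⟩
  have hs : ∀ n, 0 < ∑ a : Fin n → Fin κ, φ (List.ofFn a) := fun n =>
    Finset.sum_pos (fun a _ => hpos _) Finset.univ_nonempty
  refine ⟨exp_mul_le_of_tendsto_log hs (fun m n => ?_) hP n,
    le_mul_exp_of_tendsto_log hs hD (fun m n => ?_) hP n⟩
  · rw [sum_wordWeight_add, Finset.sum_mul]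
    exact Finset.sum_le_sum fun a _ => ((sum_wordWeight_append_bounds hle hge _ n).1).2
  · rw [sum_wordWeight_add, mul_assoc, Finset.sum_mul, Finset.mul_sum]
    refine Finset.sum_le_sum fun a _ => ?_
    rw [← mul_assoc]
    exact ((sum_wordWeight_append_bounds hle hge _ n).1).1

/-- Existence of a (not necessarily invariant) Gibbs measure for a quasi-multiplicative
potential. -/
theorem exists_gibbs {φ : List (Fin κ) → ℝ} {D P : ℝ} (hκ : 0 < κ) (hD : 0 < D)
    (hpos : ∀ u, 0 < φ u)
    (hle : ∀ u v, φ (u ++ v) ≤ φ u * φ v) (hge : ∀ u v, D⁻¹ * φ u * φ v ≤ φ (u ++ v))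
    (hP : Tendsto (fun n : ℕ => (n : ℝ)⁻¹ * Real.log (∑ a : Fin n → Fin κ, φ (List.ofFn a)))
      atTop (nhds P)) :
    ∃ ν : ProbabilityMeasure (ℕ → Fin κ), ∀ u,
      (D ^ 2)⁻¹ * Real.exp (-(u.length : ℝ) * P) * φ u ≤ (ν : Measure (ℕ → Fin κ)).real (cyl u) ∧
      (ν : Measure (ℕ → Fin κ)).real (cyl u) ≤ D * Real.exp (-(u.length : ℝ) * P) * φ u := by
  classical
  have : Nonempty (Fin κ) := ⟨⟨0, hκ⟩⟩
  let i₀ : Fin κ := ⟨0, hκ⟩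
  set s : ℕ → ℝ := fun n => ∑ a : Fin n → Fin κ, φ (List.ofFn a) with hs
  have hspos : ∀ n, 0 < s n := fun n =>
    Finset.sum_pos (fun a _ => hpos _) Finset.univ_nonempty
  have hsb : ∀ n : ℕ, Real.exp (n * P) ≤ s n ∧ s n ≤ D * Real.exp (n * P) :=
    exp_le_sum_wordWeight_le hκ hD hpos hle hge hP
  have hν : ∀ N, ∃ ν : ProbabilityMeasure (ℕ → Fin κ), ∀ C, (ν : Measure (ℕ → Fin κ)).real C =
      ∑ a : Fin N → Fin κ, φ (List.ofFn a) / s N *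
        (Measure.dirac (wordExtend i₀ (List.ofFn a))).real C := fun N =>
    ProbabilityMeasure.exists_convexCombination (fun a => (div_pos (hpos _) (hspos N)).le)
      (by rw [← Finset.sum_div]; exact div_self (hspos N).ne')
      (fun a => ⟨Measure.dirac (wordExtend i₀ (List.ofFn a)), inferInstance⟩)
  choose ν hν using hν
  have hcyl : ∀ (u : List (Fin κ)) (r : ℕ), (ν (u.length + r) : Measure (ℕ → Fin κ)).real (cyl u) =
      (∑ b : Fin r → Fin κ, φ (u ++ List.ofFn b)) / s (u.length + r) := by
    intro u r
    rw [hν, sum_wordWeight_add (fun l => φ l / s (u.length + r) *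
      (Measure.dirac (wordExtend i₀ l)).real (cyl u)), Finset.sum_eq_single u.get]
    · rw [Finset.sum_div]
      refine Finset.sum_congr rfl fun b _ => ?_
      have : wordExtend i₀ (List.ofFn u.get ++ List.ofFn b) ∈ cyl u :=
        (wordExtend_append_mem_cyl i₀ (by simp) _).2 (List.ofFn_get u)
      rw [measureReal_def, Measure.dirac_apply_of_mem this, List.ofFn_get]
      simp
    · intro a _ ha
      refine Finset.sum_eq_zero fun b _ => ?_
      have : wordExtend i₀ (List.ofFn a ++ List.ofFn b) ∉ cyl u := by
        rw [wordExtend_append_mem_cyl i₀ (by simp)]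
        intro h
        apply ha
        apply List.ofFn_injective
        rw [h, List.ofFn_get]
      rw [measureReal_def, Measure.dirac_apply' _ (measurableSet_cyl u)]
      simp [this]
    · simp
  have hbd : ∀ (u : List (Fin κ)) (r : ℕ),
      (D ^ 2)⁻¹ * Real.exp (-(u.length : ℝ) * P) * φ u ≤
        (ν (u.length + r) : Measure (ℕ → Fin κ)).real (cyl u) ∧
      (ν (u.length + r) : Measure (ℕ → Fin κ)).real (cyl u) ≤
        D * Real.exp (-(u.length : ℝ) * P) * φ u := by
    intro u r
    rw [hcyl, le_div_iff₀ (hspos _), div_le_iff₀ (hspos _)]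
    obtain ⟨h1, h2⟩ := (sum_wordWeight_append_bounds hle hge u r).1
    obtain ⟨h3, h4⟩ := hsb r
    obtain ⟨h5, h6⟩ := hsb (u.length + r)
    have he : Real.exp ((r : ℝ) * P) =
        Real.exp (-(u.length : ℝ) * P) * Real.exp (((u.length + r : ℕ) : ℝ) * P) := by
      rw [← Real.exp_add]
      congr 1
      push_cast
      ring
    have hφ := hpos u
    have hE := Real.exp_pos (-(u.length : ℝ) * P)
    constructor
    · refine le_trans ?_ h1
      calc (D ^ 2)⁻¹ * Real.exp (-(u.length : ℝ) * P) * φ u * s (u.length + r)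
          ≤ (D ^ 2)⁻¹ * Real.exp (-(u.length : ℝ) * P) * φ u *
            (D * Real.exp (((u.length + r : ℕ) : ℝ) * P)) := by gcongr
        _ = D⁻¹ * φ u * Real.exp ((r : ℝ) * P) := by
          rw [he]
          field_simp
        _ ≤ D⁻¹ * φ u * s r := by gcongr
    · refine h2.trans ?_
      calc φ u * s r ≤ φ u * (D * Real.exp ((r : ℝ) * P)) := by gcongr
        _ = D * Real.exp (-(u.length : ℝ) * P) * φ u *
            Real.exp (((u.length + r : ℕ) : ℝ) * P) := by rw [he]; ring
        _ ≤ _ := by gcongr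
  obtain ⟨l, hl, hl', ν', hν'⟩ := exists_tendsto_measureReal_clopen ν
  refine ⟨ν', fun u => ?_⟩
  have hev : ∀ᶠ N in l, ∃ r, N = u.length + r :=
    hl' ((eventually_ge_atTop u.length).mono fun N hN => Nat.exists_eq_add_of_le hN)
  have ht := hν' _ (isClopen_cyl u)
  constructor
  · refine ge_of_tendsto ht (hev.mono ?_)
    rintro _ ⟨r, rfl⟩
    exact (hbd u r).1
  · refine le_of_tendsto ht (hev.mono ?_)
    rintro _ ⟨r, rfl⟩
    exact (hbd u r).2

/-- Existence of an ergodic Gibbs measure for a quasi-multiplicative potential. -/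
theorem exists_ergodic_gibbs {φ : List (Fin κ) → ℝ} {D P : ℝ} (hκ : 0 < κ) (hD : 1 ≤ D)
    (hpos : ∀ u, 0 < φ u)
    (hle : ∀ u v, φ (u ++ v) ≤ φ u * φ v) (hge : ∀ u v, D⁻¹ * φ u * φ v ≤ φ (u ++ v))
    (hP : Tendsto (fun n : ℕ => (n : ℝ)⁻¹ * Real.log (∑ a : Fin n → Fin κ, φ (List.ofFn a)))
      atTop (nhds P)) :
    ∃ μ : Measure (ℕ → Fin κ), IsProbabilityMeasure μ ∧ Ergodic seqShift μ ∧ ∀ u,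
      (D ^ 3)⁻¹ * Real.exp (-(u.length : ℝ) * P) * φ u ≤ μ.real (cyl u) ∧
      μ.real (cyl u) ≤ D ^ 3 * Real.exp (-(u.length : ℝ) * P) * φ u := by
  have hD0 : 0 < D := by linarith
  obtain ⟨ν, hν⟩ := exists_gibbs hκ hD0 hpos hle hge hP
  have hshift : ∀ (k : ℕ) (u : List (Fin κ)),
      (D ^ 3)⁻¹ * Real.exp (-(u.length : ℝ) * P) * φ u ≤
        (ν : Measure (ℕ → Fin κ)).real (seqShift^[k] ⁻¹' cyl u) ∧
      (ν : Measure (ℕ → Fin κ)).real (seqShift^[k] ⁻¹' cyl u) ≤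
        D ^ 3 * Real.exp (-(u.length : ℝ) * P) * φ u := by
    intro k u
    have h0 := measureReal_cyl_inter (ν : Measure (ℕ → Fin κ)) [] u k
    have hnil : cyl ([] : List (Fin κ)) = Set.univ := by
      ext x
      simp [mem_cyl_iff]
    simp only [hnil, Set.univ_inter, List.length_nil, zero_add, List.nil_append] at h0
    rw [h0]
    obtain ⟨h1, h2⟩ := (sum_wordWeight_append_bounds hle hge u k).2
    obtain ⟨h3, h4⟩ := exp_le_sum_wordWeight_le hκ hD0 hpos hle hge hP k
    have he : Real.exp (-(u.length : ℝ) * P) =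
        Real.exp (-((k + u.length : ℕ) : ℝ) * P) * Real.exp ((k : ℝ) * P) := by
      rw [← Real.exp_add]
      congr 1
      push_cast
      ring
    have hφ := hpos u
    have hlen : ∀ a : Fin k → Fin κ, (List.ofFn a ++ u).length = k + u.length := fun a => by simp
    constructor
    · calc (D ^ 3)⁻¹ * Real.exp (-(u.length : ℝ) * P) * φ u
          = (D ^ 2)⁻¹ * Real.exp (-((k + u.length : ℕ) : ℝ) * P) *
            (D⁻¹ * Real.exp ((k : ℝ) * P) * φ u) := by rw [he]; field_simp
        _ ≤ (D ^ 2)⁻¹ * Real.exp (-((k + u.length : ℕ) : ℝ) * P) *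
            (D⁻¹ * (∑ a : Fin k → Fin κ, φ (List.ofFn a)) * φ u) := by gcongr
        _ ≤ (D ^ 2)⁻¹ * Real.exp (-((k + u.length : ℕ) : ℝ) * P) *
            ∑ a : Fin k → Fin κ, φ (List.ofFn a ++ u) := by gcongr
        _ ≤ _ := by
          rw [Finset.mul_sum]
          refine Finset.sum_le_sum fun a _ => ?_
          have := (hν (List.ofFn a ++ u)).1
          rwa [hlen] at this
    · calc
        ∑ a : Fin k → Fin κ, (ν : Measure (ℕ → Fin κ)).real (cyl (List.ofFn a ++ u))
          ≤ D * Real.exp (-((k + u.length : ℕ) : ℝ) * P) *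
            ∑ a : Fin k → Fin κ, φ (List.ofFn a ++ u) := by
          rw [Finset.mul_sum]
          refine Finset.sum_le_sum fun a _ => ?_
          have := (hν (List.ofFn a ++ u)).2
          rwa [hlen] at this
        _ ≤ D * Real.exp (-((k + u.length : ℕ) : ℝ) * P) *
            ((∑ a : Fin k → Fin κ, φ (List.ofFn a)) * φ u) := by gcongr
        _ ≤ D * Real.exp (-((k + u.length : ℕ) : ℝ) * P) *
            (D * Real.exp ((k : ℝ) * P) * φ u) := by gcongr
        _ = D ^ 2 * Real.exp (-(u.length : ℝ) * P) * φ u := by rw [he]; ring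
        _ ≤ _ := by
          gcongr
          norm_num
  have hm : ∀ N : ℕ, ∃ m : ProbabilityMeasure (ℕ → Fin κ), ∀ C,
      (m : Measure (ℕ → Fin κ)).real C = ∑ k : Fin (N + 1), ((N : ℝ) + 1)⁻¹ *
        (((ν : Measure (ℕ → Fin κ)).map seqShift^[k]).real C) := fun N =>
    ProbabilityMeasure.exists_convexCombination (fun _ => by positivity)
      (by simp [mul_inv_cancel₀ (by positivity : (N : ℝ) + 1 ≠ 0)])
      (fun k : Fin (N + 1) => ⟨(ν : Measure (ℕ → Fin κ)).map seqShift^[k],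
        Measure.isProbabilityMeasure_map (measurable_seqShift.iterate _).aemeasurable⟩)
  choose m hm using hm
  have hm' : ∀ N C, IsClopen C → (m N : Measure (ℕ → Fin κ)).real C = ((N : ℝ) + 1)⁻¹ *
      ∑ k ∈ Finset.range (N + 1), (ν : Measure (ℕ → Fin κ)).real (seqShift^[k] ⁻¹' C) := by
    intro N C hC
    rw [hm, ← Finset.mul_sum, Fin.sum_univ_eq_sum_range
      (fun k => ((ν : Measure (ℕ → Fin κ)).map seqShift^[k]).real C)]
    congr 1
    refine Finset.sum_congr rfl fun k _ => ?_
    rw [map_measureReal_apply (measurable_seqShift.iterate _) hC.isOpen.measurableSet]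
  obtain ⟨l, hl, hl', μ, hμ⟩ := exists_tendsto_measureReal_clopen m
  have hG : ∀ u, (D ^ 3)⁻¹ * Real.exp (-(u.length : ℝ) * P) * φ u ≤
        (μ : Measure (ℕ → Fin κ)).real (cyl u) ∧
      (μ : Measure (ℕ → Fin κ)).real (cyl u) ≤ D ^ 3 * Real.exp (-(u.length : ℝ) * P) * φ u := by
    intro u
    have ht := hμ _ (isClopen_cyl u)
    constructor
    · refine ge_of_tendsto ht (Eventually.of_forall fun N => ?_)
      rw [hm' _ _ (isClopen_cyl u), le_inv_mul_iff₀ (by positivity)]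
      have := Finset.card_nsmul_le_sum (Finset.range (N + 1)) _ _ fun k _ => (hshift k u).1
      simpa using this
    · refine le_of_tendsto ht (Eventually.of_forall fun N => ?_)
      rw [hm' _ _ (isClopen_cyl u), inv_mul_le_iff₀ (by positivity)]
      have := Finset.sum_le_card_nsmul (Finset.range (N + 1)) _ _ fun k _ => (hshift k u).2
      simpa using this
  have hinv : MeasurePreserving seqShift (μ : Measure (ℕ → Fin κ)) μ := by
    refine measurePreserving_seqShift_of_clopen fun C hC => ?_
    have hC' : IsClopen (seqShift ⁻¹' C) := hC.preimage continuous_seqShift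
    have h1 := (hμ _ hC').sub (hμ _ hC)
    have h2 : Tendsto (fun N : ℕ => ((N : ℝ) + 1)⁻¹) l (nhds 0) := by
      have := tendsto_one_div_add_atTop_nhds_zero_nat (𝕜 := ℝ)
      simp only [one_div] at this
      exact this.mono_left hl'
    have h3 : Tendsto (fun N => (m N : Measure (ℕ → Fin κ)).real (seqShift ⁻¹' C) -
        (m N : Measure (ℕ → Fin κ)).real C) l (nhds 0) := by
      refine squeeze_zero_norm (fun N => ?_) h2
      rw [hm' _ _ hC', hm' _ _ hC, ← mul_sub, ← Finset.sum_sub_distrib]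
      have : ∀ k, seqShift^[k] ⁻¹' (seqShift ⁻¹' C) = seqShift^[k + 1] ⁻¹' C := fun k => by
        rw [Function.iterate_succ', Set.preimage_comp]
      simp only [this]
      rw [Finset.sum_range_sub (fun k => (ν : Measure (ℕ → Fin κ)).real (seqShift^[k] ⁻¹' C)),
        norm_mul, Real.norm_of_nonneg (by positivity)]
      refine mul_le_of_le_one_right (by positivity) ?_
      rw [Real.norm_eq_abs, abs_le]
      have a1 := measureReal_nonneg (μ := (ν : Measure (ℕ → Fin κ))) (s := seqShift^[N + 1] ⁻¹' C)
      have a2 := measureReal_le_one (μ := (ν : Measure (ℕ → Fin κ))) (s := seqShift^[N + 1] ⁻¹' C)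
      have a3 := measureReal_nonneg (μ := (ν : Measure (ℕ → Fin κ))) (s := seqShift^[0] ⁻¹' C)
      have a4 := measureReal_le_one (μ := (ν : Measure (ℕ → Fin κ))) (s := seqShift^[0] ⁻¹' C)
      constructor <;> linarith
    exact sub_eq_zero.1 (tendsto_nhds_unique h1 h3)
  refine ⟨μ, inferInstance, ergodic_seqShift_of_quasiBernoulli hinv
    (K := (D ^ 10)⁻¹) (by positivity) (fun u v => ?_), hG⟩
  have e : Real.exp (-((u ++ v).length : ℝ) * P) =
      Real.exp (-(u.length : ℝ) * P) * Real.exp (-(v.length : ℝ) * P) := by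
    rw [← Real.exp_add, List.length_append]
    congr 1
    push_cast
    ring
  have hφu := hpos u
  have hφv := hpos v
  calc (D ^ 10)⁻¹ * (μ : Measure (ℕ → Fin κ)).real (cyl u) *
        (μ : Measure (ℕ → Fin κ)).real (cyl v)
      ≤ (D ^ 10)⁻¹ * (D ^ 3 * Real.exp (-(u.length : ℝ) * P) * φ u) *
        (D ^ 3 * Real.exp (-(v.length : ℝ) * P) * φ v) := by
        gcongr
        · exact (hG u).2
        · exact (hG v).2
    _ = (D ^ 3)⁻¹ * Real.exp (-((u ++ v).length : ℝ) * P) * (D⁻¹ * φ u * φ v) := by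
        rw [e]
        field_simp
    _ ≤ (D ^ 3)⁻¹ * Real.exp (-((u ++ v).length : ℝ) * P) * φ (u ++ v) := by
        gcongr
        exact hge u v
    _ ≤ _ := (hG (u ++ v)).1

end GibbsMeasure

section SingularValueFunction

variable {d κ : ℕ}

theorem Matrix.injective_toEuclideanLin {A : Matrix (Fin d) (Fin d) ℝ} (hA : IsUnit A.det) :
    Function.Injective (Matrix.toEuclideanLin A) := by
  intro x y hxy
  have h : A.mulVec x.ofLp = A.mulVec y.ofLp := by
    simpa [Matrix.toLpLin_apply] using hxy
  have h2 := congrArg (A⁻¹.mulVec ·) h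
  simp only [Matrix.mulVec_mulVec, Matrix.nonsing_inv_mul _ hA, Matrix.one_mulVec] at h2
  exact WithLp.ofLp_injective 2 h2

theorem Matrix.singularValues_toEuclideanLin_pos {A : Matrix (Fin d) (Fin d) ℝ}
    (hA : IsUnit A.det) {k : ℕ} (hk : k < d) :
    0 < (Matrix.toEuclideanLin A).singularValues k :=
  (LinearMap.injective_iff_forall_lt_finrank_singularValues_pos _).1
    (Matrix.injective_toEuclideanLin hA) k (by simpa using hk)

theorem Matrix.prod_singularValues_pos {A : Matrix (Fin d) (Fin d) ℝ}
    (hA : IsUnit A.det) {k : ℕ} (hk : k ≤ d) :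
    0 < ∏ i ∈ Finset.range k, (Matrix.toEuclideanLin A).singularValues i :=
  Finset.prod_pos fun _ hi =>
    Matrix.singularValues_toEuclideanLin_pos hA ((Finset.mem_range.1 hi).trans_le hk)

theorem Matrix.prod_singularValues_mul_le (A : Matrix (Fin d) (Fin d) ℝ)
    {B : Matrix (Fin d) (Fin d) ℝ} (hB : IsUnit B.det) {k : ℕ} (hk : k ≤ d) :
    ∏ i ∈ Finset.range k, (Matrix.toEuclideanLin (A * B)).singularValues i ≤
      (∏ i ∈ Finset.range k, (Matrix.toEuclideanLin A).singularValues i) *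
        ∏ i ∈ Finset.range k, (Matrix.toEuclideanLin B).singularValues i := by
  rw [Matrix.toLpLin_mul_same]
  exact LinearMap.prod_singularValues_comp_le _ _ (Matrix.injective_toEuclideanLin hB)
    (by simpa using hk)

theorem LinearMap.singularValues_le_of_norm_le {E F : Type*} [NormedAddCommGroup E]
    [InnerProductSpace ℝ E] [FiniteDimensional ℝ E] [NormedAddCommGroup F] [InnerProductSpace ℝ F]
    [FiniteDimensional ℝ F] (T : E →ₗ[ℝ] F) {M : ℝ} (hT : ∀ x, ‖T x‖ ≤ M * ‖x‖) {k : ℕ}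
    (hk : k < Module.finrank ℝ E) : T.singularValues k ≤ M := by
  obtain ⟨W, -, hWd, hW⟩ := T.exists_monotone_submodule_singularValues_le
  have hne : W (k + 1) ≠ ⊥ := by
    intro h
    have := hWd (k + 1) hk
    rw [h, finrank_bot] at this
    omega
  obtain ⟨x, hx, hx0⟩ := Submodule.exists_mem_ne_zero_of_ne_bot hne
  exact le_of_mul_le_mul_right ((hW k x hx).trans (hT x)) (norm_pos_iff.2 hx0)

theorem LinearMap.le_singularValues_of_le_norm {E F : Type*} [NormedAddCommGroup E]
    [InnerProductSpace ℝ E] [FiniteDimensional ℝ E] [NormedAddCommGroup F] [InnerProductSpace ℝ F]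
    [FiniteDimensional ℝ F] (T : E →ₗ[ℝ] F) {m : ℝ} (hT : ∀ x, m * ‖x‖ ≤ ‖T x‖) {k : ℕ}
    (hk : k < Module.finrank ℝ E) : m ≤ T.singularValues k := by
  obtain ⟨x, -, hx, hle⟩ := T.exists_norm_le_singularValues (k := k) (W := ⊤) (by simpa using hk)
  have := hT x
  rw [hx, mul_one] at this
  exact this.trans hle

theorem svf_eq_of_lt (A : Matrix (Fin d) (Fin d) ℝ) (hA : IsUnit A.det) {t : ℝ} (ht : 0 ≤ t)
    (htd : t < d) : svf A t =
      (∏ i ∈ Finset.range ⌊t⌋₊, (Matrix.toEuclideanLin A).singularValues i) ^ (1 - (t - ⌊t⌋₊)) *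
      (∏ i ∈ Finset.range (⌊t⌋₊ + 1), (Matrix.toEuclideanLin A).singularValues i) ^
        (t - ⌊t⌋₊) := by
  have hl : ⌊t⌋₊ < d := (Nat.floor_lt ht).2 htd
  have hp := Matrix.prod_singularValues_pos hA hl.le
  have hs := Matrix.singularValues_toEuclideanLin_pos hA hl
  rw [svf, if_pos htd, singVal_eq_singularValues A hl, Finset.prod_range_succ,
    Real.mul_rpow hp.le hs.le, ← mul_assoc, ← Real.rpow_add hp]
  congr 1
  rw [sub_add_cancel, Real.rpow_one]
  exact Finset.prod_congr rfl fun i hi =>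
    singVal_eq_singularValues A ((Finset.mem_range.1 hi).trans hl)

theorem svf_pos {A : Matrix (Fin d) (Fin d) ℝ} (hA : IsUnit A.det) {t : ℝ} (ht : 0 ≤ t) :
    0 < svf A t := by
  by_cases htd : t < d
  · have hl : ⌊t⌋₊ < d := (Nat.floor_lt ht).2 htd
    rw [svf_eq_of_lt A hA ht htd]
    exact mul_pos (Real.rpow_pos_of_pos (Matrix.prod_singularValues_pos hA hl.le) _)
      (Real.rpow_pos_of_pos (Matrix.prod_singularValues_pos hA hl) _)
  · rw [svf, if_neg htd]
    exact Real.rpow_pos_of_pos (abs_pos.2 hA.ne_zero) _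

theorem svf_mul_le {A B : Matrix (Fin d) (Fin d) ℝ} (hA : IsUnit A.det) (hB : IsUnit B.det)
    {t : ℝ} (ht : 0 ≤ t) : svf (A * B) t ≤ svf A t * svf B t := by
  by_cases htd : t < d
  · have hl : ⌊t⌋₊ < d := (Nat.floor_lt ht).2 htd
    have hAB : IsUnit (A * B).det := by
      rw [Matrix.det_mul]
      exact hA.mul hB
    rw [svf_eq_of_lt _ hAB ht htd, svf_eq_of_lt A hA ht htd, svf_eq_of_lt B hB ht htd,
      mul_mul_mul_comm, ← Real.mul_rpow (Matrix.prod_singularValues_pos hA hl.le).le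
        (Matrix.prod_singularValues_pos hB hl.le).le,
      ← Real.mul_rpow (Matrix.prod_singularValues_pos hA hl).le
        (Matrix.prod_singularValues_pos hB hl).le]
    have h1 := Nat.floor_le ht
    have h2 := Nat.lt_floor_add_one t
    refine mul_le_mul ?_ ?_ ?_ ?_
    · exact Real.rpow_le_rpow (Matrix.prod_singularValues_pos hAB hl.le).le
        (Matrix.prod_singularValues_mul_le A hB hl.le) (by linarith)
    · exact Real.rpow_le_rpow (Matrix.prod_singularValues_pos hAB hl).le
        (Matrix.prod_singularValues_mul_le A hB hl) (by linarith)
    · exact Real.rpow_nonneg (Matrix.prod_singularValues_pos hAB hl).le _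
    · exact Real.rpow_nonneg (mul_pos (Matrix.prod_singularValues_pos hA hl.le)
        (Matrix.prod_singularValues_pos hB hl.le)).le _
  · simp only [svf, if_neg htd]
    rw [Matrix.det_mul, abs_mul, Real.mul_rpow (abs_nonneg _) (abs_nonneg _)]

theorem svf_one_le {t : ℝ} (ht : 0 ≤ t) : svf (1 : Matrix (Fin d) (Fin d) ℝ) t ≤ 1 := by
  by_cases htd : t < d
  · have hl : ⌊t⌋₊ < d := (Nat.floor_lt ht).2 htd
    have h1 : ∀ k < d,
        (Matrix.toEuclideanLin (1 : Matrix (Fin d) (Fin d) ℝ)).singularValues k ≤ 1 := fun k hk =>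
      LinearMap.singularValues_le_of_norm_le _ (fun x => by simp) (by simpa using hk)
    have hp : ∀ k ≤ d, ∏ i ∈ Finset.range k,
        (Matrix.toEuclideanLin (1 : Matrix (Fin d) (Fin d) ℝ)).singularValues i ≤ 1 := fun k hk =>
      Finset.prod_le_one (fun i _ => LinearMap.singularValues_nonneg _ i)
        fun i hi => h1 i ((Finset.mem_range.1 hi).trans_le hk)
    have hU : IsUnit (1 : Matrix (Fin d) (Fin d) ℝ).det := by simp
    rw [svf_eq_of_lt _ hU ht htd]
    have h1 := Nat.floor_le ht
    have h2 := Nat.lt_floor_add_one t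
    exact mul_le_one₀ (Real.rpow_le_one (Matrix.prod_singularValues_pos hU hl.le).le
      (hp _ hl.le) (by linarith)) (Real.rpow_nonneg (Matrix.prod_singularValues_pos hU hl).le _)
      (Real.rpow_le_one (Matrix.prod_singularValues_pos hU hl).le (hp _ hl) (by linarith))
  · simp [svf, htd]

theorem wprod_append (A : Fin κ → Matrix (Fin d) (Fin d) ℝ) (u v : List (Fin κ)) :
    wprod A (u ++ v) = wprod A u * wprod A v := by
  simp [wprod]

theorem isUnit_det_wprod {A : Fin κ → Matrix (Fin d) (Fin d) ℝ} (hA : ∀ i, IsUnit (A i).det)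
    (u : List (Fin κ)) : IsUnit (wprod A u).det := by
  induction u with
  | nil => simp [wprod]
  | cons i u ih =>
    rw [← List.singleton_append, wprod_append, Matrix.det_mul]
    exact IsUnit.mul (by simpa [wprod] using hA i) ih

theorem toEuclideanLin_wprod_cons (A : Fin κ → Matrix (Fin d) (Fin d) ℝ) (i : Fin κ)
    (u : List (Fin κ)) (x : EuclideanSpace ℝ (Fin d)) :
    Matrix.toEuclideanLin (wprod A (i :: u)) x =
      Matrix.toEuclideanLin (A i) (Matrix.toEuclideanLin (wprod A u) x) := by
  rw [wprod, List.map_cons, List.prod_cons, Matrix.toLpLin_mul_same]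
  rfl

theorem norm_toEuclideanLin_wprod_le {A : Fin κ → Matrix (Fin d) (Fin d) ℝ} {M : ℝ} (hM : 0 ≤ M)
    (hA : ∀ i x, ‖Matrix.toEuclideanLin (A i) x‖ ≤ M * ‖x‖) (u : List (Fin κ))
    (x : EuclideanSpace ℝ (Fin d)) :
    ‖Matrix.toEuclideanLin (wprod A u) x‖ ≤ M ^ u.length * ‖x‖ := by
  induction u with
  | nil => simp [wprod]
  | cons i u ih =>
    rw [toEuclideanLin_wprod_cons, List.length_cons, pow_succ', mul_assoc]
    exact (hA i _).trans (mul_le_mul_of_nonneg_left ih hM)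

theorem le_norm_toEuclideanLin_wprod {A : Fin κ → Matrix (Fin d) (Fin d) ℝ} {m : ℝ} (hm : 0 ≤ m)
    (hA : ∀ i x, m * ‖x‖ ≤ ‖Matrix.toEuclideanLin (A i) x‖) (u : List (Fin κ))
    (x : EuclideanSpace ℝ (Fin d)) :
    m ^ u.length * ‖x‖ ≤ ‖Matrix.toEuclideanLin (wprod A u) x‖ := by
  induction u with
  | nil => simp [wprod]
  | cons i u ih =>
    rw [toEuclideanLin_wprod_cons, List.length_cons, pow_succ', mul_assoc]
    exact (mul_le_mul_of_nonneg_left ih hm).trans (hA i _)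

theorem exists_pos_le_norm_toEuclideanLin {A : Fin κ → Matrix (Fin d) (Fin d) ℝ}
    (hA : ∀ i, IsUnit (A i).det) :
    ∃ m : ℝ, 0 < m ∧ ∀ i x, m * ‖x‖ ≤ ‖Matrix.toEuclideanLin (A i) x‖ := by
  have h : ∀ i, ∃ K : NNReal, AntilipschitzWith K (Matrix.toEuclideanLin (A i)) := fun i => by
    obtain ⟨K, -, hK⟩ := (Matrix.toEuclideanLin (A i)).exists_antilipschitzWith
      (LinearMap.ker_eq_bot.2 (Matrix.injective_toEuclideanLin (hA i)))
    exact ⟨K, hK⟩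
  choose K hK using h
  obtain ⟨B, hB⟩ := (Set.finite_range K).bddAbove
  refine ⟨((B : ℝ) + 1)⁻¹, by positivity, fun i x => ?_⟩
  rw [inv_mul_le_iff₀ (by positivity)]
  have h1 := (hK i).le_mul_norm_sub x 0
  rw [map_zero, add_zero, add_zero, norm_neg, norm_neg] at h1
  refine h1.trans (mul_le_mul_of_nonneg_right ?_ (norm_nonneg _))
  have h2 : (K i : ℝ) ≤ B := NNReal.coe_le_coe.2 (hB ⟨i, rfl⟩)
  linarith

end SingularValueFunction

section LyapunovExponents

variable {d κ : ℕ}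

theorem ofFn_seq_add (x : ℕ → Fin κ) (m n : ℕ) :
    List.ofFn (fun j : Fin (m + n) => x j) =
      List.ofFn (fun j : Fin m => x j) ++ List.ofFn (fun j : Fin n => seqShift^[m] x j) := by
  rw [List.ofFn_add]
  congr 1
  simp [seqShift_iterate]

/-- Along almost every sequence, the singular values of the matrix products have exponential
growth rates. -/
theorem exists_ae_tendsto_log_singularValues {A : Fin κ → Matrix (Fin d) (Fin d) ℝ}
    (hA : ∀ i, IsUnit (A i).det) {μ : Measure (ℕ → Fin κ)} [IsProbabilityMeasure μ]
    (hμ : Ergodic seqShift μ) {C : ℝ}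
    (hC : ∀ u : List (Fin κ), ∀ k < d,
      |Real.log ((Matrix.toEuclideanLin (wprod A u)).singularValues k)| ≤ C * u.length) :
    ∃ χ : Fin d → ℝ, ∀ᵐ x ∂μ, ∀ k : Fin d, Tendsto (fun n : ℕ => Real.log
      ((Matrix.toEuclideanLin (wprod A (List.ofFn fun j : Fin n => x j))).singularValues k) / n)
      atTop (nhds (χ k)) := by
  have key : ∀ k ≤ d, ∃ L : ℝ, ∀ᵐ x ∂μ, Tendsto (fun n : ℕ => Real.log (∏ i ∈ Finset.range k,
      (Matrix.toEuclideanLin (wprod A (List.ofFn fun j : Fin n => x j))).singularValues i) / n)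
      atTop (nhds L) := by
    intro k hk
    refine Ergodic.ae_tendsto_subadditive_div (C := k * C) hμ
      (f := fun n x => Real.log (∏ i ∈ Finset.range k,
        (Matrix.toEuclideanLin (wprod A (List.ofFn fun j : Fin n => x j))).singularValues i))
      (fun n => ?_) (fun n x => ?_) (fun m n x => ?_)
    · exact (Measurable.of_discrete (f := fun a : Fin n → Fin κ => Real.log (∏ i ∈ Finset.range k,
        (Matrix.toEuclideanLin (wprod A (List.ofFn a))).singularValues i))).comp
        (measurable_seqInit n)
    · rw [Real.log_prod fun i hi => (Matrix.singularValues_toEuclideanLin_pos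
        (isUnit_det_wprod hA _) ((Finset.mem_range.1 hi).trans_le hk)).ne']
      refine (Finset.abs_sum_le_sum_abs _ _).trans ?_
      refine (Finset.sum_le_card_nsmul _ _ (C * n) fun i hi => ?_).trans ?_
      · have := hC (List.ofFn fun j : Fin n => x j) i ((Finset.mem_range.1 hi).trans_le hk)
        rwa [List.length_ofFn] at this
      · rw [Finset.card_range, nsmul_eq_mul, mul_assoc]
    · have h1 := isUnit_det_wprod hA (List.ofFn fun j : Fin m => x j)
      have h2 := isUnit_det_wprod hA (List.ofFn fun j : Fin n => seqShift^[m] x j)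
      have h3 := isUnit_det_wprod hA (List.ofFn fun j : Fin (m + n) => x j)
      have h4 := Matrix.prod_singularValues_pos h3 hk
      rw [← Real.log_mul (Matrix.prod_singularValues_pos h1 hk).ne'
        (Matrix.prod_singularValues_pos h2 hk).ne']
      refine Real.log_le_log h4 ?_
      rw [ofFn_seq_add, wprod_append]
      exact Matrix.prod_singularValues_mul_le _ h2 hk
  choose L hL using fun k : Fin (d + 1) => key k (Nat.lt_succ_iff.1 k.2)
  refine ⟨fun k => L k.succ - L k.castSucc, ?_⟩
  filter_upwards [ae_all_iff.2 hL] with x hx k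
  refine ((hx k.succ).sub (hx k.castSucc)).congr fun n => ?_
  have hU := isUnit_det_wprod hA (List.ofFn fun j : Fin n => x j)
  rw [Fin.val_succ, Fin.val_castSucc, Finset.prod_range_succ,
    Real.log_mul (Matrix.prod_singularValues_pos hU k.2.le).ne'
      (Matrix.singularValues_toEuclideanLin_pos hU k.2).ne']
  ring

end LyapunovExponents

/-- Existence of a Gibbs-type measure for the singular value function, together with
`μ`-a.e. exponential rates `λ_k` for all the singular values along orbits. -/
theorem semiconformal_measure (d κ : ℕ) (hκ : 2 ≤ κ)
    (A : Fin κ → Matrix (Fin d) (Fin d) ℝ) (ᾱ : ℝ) (hᾱ : ᾱ < 1)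
    (hinv : ∀ i, IsUnit (A i).det) (hnorm : ∀ i, opN (A i) ≤ ᾱ)
    (t : ℝ) (ht : 0 ≤ t) (D : ℝ) (hD : 1 ≤ D)
    (hsub : ∀ li lj : List (Fin κ), li ≠ [] → lj ≠ [] →
      D⁻¹ * svf (wprod A li) t * svf (wprod A lj) t ≤ svf (wprod A (li ++ lj)) t)
    (Pt : ℝ)
    (hP : Tendsto (fun n : ℕ =>
      (n : ℝ)⁻¹ * Real.log (∑ f : Fin n → Fin κ, svf (wprod A (List.ofFn f)) t))
      atTop (nhds Pt)) :
    ∃ μ : Measure (ℕ → Fin κ), IsProbabilityMeasure μ ∧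
      ∃ c : ℝ, 1 ≤ c ∧
      ∃ lam : Fin d → ℝ, (∀ k, 0 < lam k ∧ lam k < 1) ∧ Antitone lam ∧
        (∀ li : List (Fin κ), li ≠ [] →
          ENNReal.ofReal (c⁻¹ * Real.exp (-(li.length : ℝ) * Pt) * svf (wprod A li) t)
            ≤ μ (cyl li) ∧
          μ (cyl li) ≤
            ENNReal.ofReal (c * Real.exp (-(li.length : ℝ) * Pt) * svf (wprod A li) t)) ∧
        (∀ᵐ x ∂μ, ∀ k : Fin d,
          Tendsto (fun n : ℕ =>
              singVal (wprod A (List.ofFn fun j : Fin n => x j)) ((k : ℕ) + 1) ^ ((n : ℝ)⁻¹))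
            atTop (nhds (lam k))) := by
  have hκ0 : 0 < κ := by omega
  set M : ℝ := max ᾱ (1 / 2)
  have hM0 : 0 < M := lt_max_of_lt_right (by norm_num)
  have hM1 : M < 1 := max_lt hᾱ (by norm_num)
  have hAM : ∀ i x, ‖Matrix.toEuclideanLin (A i) x‖ ≤ M * ‖x‖ := fun i x =>
    ((LinearMap.toContinuousLinearMap (Matrix.toEuclideanLin (A i))).le_opNorm x).trans
      (mul_le_mul_of_nonneg_right ((hnorm i).trans (le_max_left _ _)) (norm_nonneg x))
  obtain ⟨m, hm0, hAm⟩ := exists_pos_le_norm_toEuclideanLin hinv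
  have hlog : ∀ u : List (Fin κ), ∀ k < d,
      u.length * Real.log m ≤ Real.log ((Matrix.toEuclideanLin (wprod A u)).singularValues k) ∧
      Real.log ((Matrix.toEuclideanLin (wprod A u)).singularValues k) ≤
        u.length * Real.log M := by
    intro u k hk
    have hpos := Matrix.singularValues_toEuclideanLin_pos (isUnit_det_wprod hinv u) hk
    constructor
    · rw [← Real.log_pow]
      exact Real.log_le_log (pow_pos hm0 _) (LinearMap.le_singularValues_of_le_norm _
        (le_norm_toEuclideanLin_wprod hm0.le hAm u) (by simpa using hk))
    · rw [← Real.log_pow]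
      exact Real.log_le_log hpos (LinearMap.singularValues_le_of_norm_le _
        (norm_toEuclideanLin_wprod_le hM0.le hAM u) (by simpa using hk))
  have hpos : ∀ u, 0 < svf (wprod A u) t := fun u => svf_pos (isUnit_det_wprod hinv u) ht
  have hnil : svf (wprod A []) t ≤ 1 := svf_one_le ht
  have hDinv : D⁻¹ ≤ 1 := inv_le_one_of_one_le₀ hD
  have hge : ∀ u v, D⁻¹ * svf (wprod A u) t * svf (wprod A v) t ≤ svf (wprod A (u ++ v)) t := by
    intro u v
    rcases eq_or_ne u [] with rfl | hu
    · exact mul_le_of_le_one_left (hpos v).le (mul_le_one₀ hDinv (hpos []).le hnil)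
    rcases eq_or_ne v [] with rfl | hv
    · rw [List.append_nil, mul_right_comm]
      exact mul_le_of_le_one_left (hpos u).le (mul_le_one₀ hDinv (hpos []).le hnil)
    exact hsub u v hu hv
  obtain ⟨μ, hμ, herg, hG⟩ := exists_ergodic_gibbs (φ := fun u => svf (wprod A u) t) hκ0 hD hpos
    (fun u v => by
      simp only [wprod_append]
      exact svf_mul_le (isUnit_det_wprod hinv u) (isUnit_det_wprod hinv v) ht) hge hP
  obtain ⟨χ, hχ⟩ := exists_ae_tendsto_log_singularValues hinv herg
    (C := max (-Real.log m) (-Real.log M)) (fun u k hk => by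
      obtain ⟨h1, h2⟩ := hlog u k hk
      have h3 : Real.log M ≤ 0 := Real.log_nonpos hM0.le hM1.le
      have h4 : (0 : ℝ) ≤ u.length := Nat.cast_nonneg _
      rw [abs_le]
      constructor
      · nlinarith [le_max_left (-Real.log m) (-Real.log M)]
      · nlinarith [le_max_right (-Real.log m) (-Real.log M)])
  obtain ⟨x₀, hx₀⟩ := hχ.exists
  refine ⟨μ, hμ, D ^ 3, one_le_pow₀ hD, fun k => Real.exp (χ k), fun k => ⟨Real.exp_pos _, ?_⟩,
    fun j k hjk => ?_, fun u _ => ?_, ?_⟩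
  · rw [Real.exp_lt_one_iff]
    refine lt_of_le_of_lt (b := Real.log M) ?_ (Real.log_neg hM0 hM1)
    refine le_of_tendsto (hx₀ k) ((eventually_gt_atTop 0).mono fun n hn => ?_)
    have := (hlog (List.ofFn fun j : Fin n => x₀ j) k k.2).2
    rw [List.length_ofFn] at this
    rw [div_le_iff₀ (by exact_mod_cast hn)]
    linarith
  · refine Real.exp_le_exp.2 (le_of_tendsto_of_tendsto' (hx₀ k) (hx₀ j) fun n => ?_)
    refine div_le_div_of_nonneg_right (Real.log_le_log (Matrix.singularValues_toEuclideanLin_pos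
      (isUnit_det_wprod hinv _) k.2) (LinearMap.singularValues_antitone _ hjk)) (Nat.cast_nonneg n)
  · obtain ⟨h1, h2⟩ := hG u
    rw [← ofReal_measureReal]
    exact ⟨ENNReal.ofReal_le_ofReal h1, ENNReal.ofReal_le_ofReal h2⟩
  · filter_upwards [hχ] with x hx k
    refine ((Real.continuous_exp.tendsto _).comp (hx k)).congr fun n => ?_
    rw [singVal_eq_singularValues _ k.2, Real.rpow_def_of_pos
      (Matrix.singularValues_toEuclideanLin_pos (isUnit_det_wprod hinv _) k.2)]
    rfl

end
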